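/- arXiv:math/0002223 — 2 statements merged into one kernel-verified Lean document; each statement's English description precedes it below -/
import Mathlib

section
/- Let K be an invertible symmetric positive-definite n×n matrix with nonnegative integer entries, D := det K, and let (Q^(k), a^(k), b^(k)), k = 0, …, L−1, be a Durfee system for K. Fix an indeterminate v, set q := v^{2D}, and for any rational r with 2Dr ∈ ℤ interpret q^r := v^{2Dr}. Extend the q-binomial by declaring [x choose y]_q := 0 unless both x and y are integers with 0 ≤ y ≤ x. For an n×n symmetric rational matrix A and vectors Q̃, u ∈ ℚ^n define the finite sum Z(A; Q̃, u | z; q) := Σ_{m ∈ (ℤ≥0)^n} (∏_i z_i^{m_i}) q^{(1/2) m·A·m + Q̃·m} ∏_i [((I−A)·m + u)_i choose m_i]_q, where I is the identity matrix. Set Q'^(k) := −K^{−1}·Q^(k) and z'_i := ∏_j z_j^{−K_{ij}}. Then for all M, N ∈ (ℤ≥0)^n, the following identity holds in the field of rational functions ℚ(v, z₁, …, z_n): Σ_{k=0}^{L−1} (∏_i z_i^{−Q^(k)_i}) q^{(1/2) Q^(k)·K^{−1}·Q^(k) + a^(k)·b^(k)} · Z(K; Q^(k)+b^(k), M−(Q^(k)+b^(k))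 | z'; q) · Z(K^{−1}; Q'^(k)+a^(k), N−(Q'^(k)+a^(k)) | z; q) = Σ_{p ∈ ℤ^n} (∏_i z_i^{p_i}) q^{(1/2) p·K^{−1}·p} ∏_i [M_i + N_i + ((I−K^{−1})·p)_i choose M_i + p_i]_q, where all occurring sums are finite because of the vanishing conventions for the q-binomial. -/
open Matrix

noncomputable section

/-- The field of rational functions `ℚ(q, z₁, …, z_n)`; the variable indexed by `none`
plays the role of `q` and the variable indexed by `some i` plays the role of `z i`. -/
abbrev FF (n : ℕ) := FractionRing (MvPolynomial (Option (Fin n)) ℚ)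

/-- The indeterminate `q`. -/
def qv (n : ℕ) : FF n :=
  algebraMap (MvPolynomial (Option (Fin n)) ℚ) (FF n) (MvPolynomial.X (none : Option (Fin n)))

/-- The indeterminates `z i`. -/
def zv (n : ℕ) (i : Fin n) : FF n :=
  algebraMap (MvPolynomial (Option (Fin n)) ℚ) (FF n) (MvPolynomial.X (some i))

/-- The q-Pochhammer symbol `(z; q)_M = ∏_{k=1}^M (1 - z q^{k-1})`. -/
def qPoch {F : Type*} [CommRing F] (q z : F) (M : ℕ) : F :=
  ∏ k ∈ Finset.range M, (1 - z * q ^ k)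

/-- The q-binomial `[x choose y]_q = (q;q)_x / ((q;q)_y (q;q)_{x-y})` for `0 ≤ y ≤ x`,
and `0` otherwise. -/
def qBinom {F : Type*} [Field F] (q : F) (x y : ℤ) : F :=
  if 0 ≤ y ∧ y ≤ x then qPoch q q x.toNat / (qPoch q q y.toNat * qPoch q q (x - y).toNat)
  else 0

/-- A Durfee system of length `L` for the `n × n` matrix `K`:  a family of triples of
vectors `(Q k, a k, b k) ∈ ((ℤ≥0)^n)³`, `k = 0, …, L-1`, such that for every
`M ∈ (ℤ≥0)^n` one has, as rational functions in `q, z₁, …, z_n`,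
`1/∏_i (z_i q; q)_{M_i} = Σ_k Σ_{m ∈ (ℤ≥0)^n} (∏_i z_i^{m_i + a_i}) q^{(m+a)·(N+b)}
  (1/∏_i (z_i q;q)_{N_i}) ∏_i [M_i + m_i - N_i - b_i choose m_i]_q`
with `N := K·m + Q k`.  (The inner sum, a priori over all of `(ℤ≥0)^n`, has finite
support since the q-binomial factors vanish unless `N_i + b_i ≤ M_i`.) -/
def IsDurfeeSystem {n L : ℕ} (K : Matrix (Fin n) (Fin n) ℕ)
    (Q a b : Fin L → Fin n → ℕ) : Prop :=
  ∀ M : Fin n → ℕ,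
    (∏ i, qPoch (qv n) (zv n i * qv n) (M i))⁻¹ =
      ∑ k : Fin L, ∑ᶠ m : Fin n → ℕ,
        (∏ i, zv n i ^ (m i + a k i)) *
        qv n ^ (∑ i, (m i + a k i) * (K.mulVec m i + Q k i + b k i)) *
        (∏ i, qPoch (qv n) (zv n i * qv n) (K.mulVec m i + Q k i))⁻¹ *
        ∏ i, qBinom (qv n) ((M i : ℤ) + m i - (K.mulVec m i + Q k i : ℕ) - b k i) (m i)

/-! For Statement 5 we work in the field `FF n = ℚ(v, z₁, …, z_n)`, where now the
variable `qv n` (indexed by `none`) plays the role of the indeterminate `v`; we set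
`q := v^(2D)` and interpret `q^r := v^(2Dr)` for rationals `r` with `2Dr ∈ ℤ`. -/

/-- `q^r := v^(2Dr)` for a rational exponent `r` (meaningful when `2Dr ∈ ℤ`). -/
def qpow (n D : ℕ) (r : ℚ) : FF n := qv n ^ (2 * (D : ℚ) * r).num

/-- The q-binomial with rational arguments: `[x choose y]_q = 0` unless both `x` and `y`
are integers with `0 ≤ y ≤ x`. -/
def qBinomQ {F : Type*} [Field F] (q : F) (x y : ℚ) : F :=
  if x.den = 1 ∧ y.den = 1 then qBinom q x.num y.num else 0

/-- The (finitized) Universal Chiral Partition Function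
`Z(A; Q̃, u | z; q) = Σ_{m ∈ (ℤ≥0)^n} (∏_i z_i^{m_i}) q^{½ m·A·m + Q̃·m}
  ∏_i [((I-A)·m + u)_i choose m_i]_q`,
with `q = v^(2D)`, `q^r` interpreted as `v^(2Dr)`, and the extended q-binomial
vanishing unless its arguments are integers `0 ≤ y ≤ x`.  The sum has finite support. -/
def Zucpf (n D : ℕ) (A : Matrix (Fin n) (Fin n) ℚ) (Qt u : Fin n → ℚ)
    (z : Fin n → FF n) : FF n :=
  ∑ᶠ m : Fin n → ℕ,
    (∏ i, z i ^ m i) *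
    qpow n D ((1 / 2) * ((fun i => (m i : ℚ)) ⬝ᵥ A.mulVec (fun i => (m i : ℚ))) +
      Qt ⬝ᵥ (fun i => (m i : ℚ))) *
    ∏ i, qBinomQ (qv n ^ (2 * D)) (((1 - A).mulVec (fun j => (m j : ℚ)) + u) i)
      ((m i : ℚ))


section Evaluation

variable {n : ℕ} {A : Type*} [Field A]

/-- `f` is a quotient of polynomials whose denominator does not vanish under `ev`, and `x` is the
value of that quotient. -/
def EvaluatesTo (ev : MvPolynomial (Option (Fin n)) ℚ →+* A) (f : FF n) (x : A) : Prop :=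
  ∃ r s : MvPolynomial (Option (Fin n)) ℚ, ev s ≠ 0 ∧
    f * algebraMap _ (FF n) s = algebraMap _ (FF n) r ∧ x * ev s = ev r

variable {ev : MvPolynomial (Option (Fin n)) ℚ →+* A} {f g : FF n} {x y : A}

namespace EvaluatesTo

theorem of_polynomial (r : MvPolynomial (Option (Fin n)) ℚ) :
    EvaluatesTo ev (algebraMap _ (FF n) r) (ev r) :=
  ⟨r, 1, by simp, by simp, by simp⟩

theorem zero : EvaluatesTo ev 0 0 := by simpa using of_polynomial (ev := ev) 0

theorem one : EvaluatesTo ev 1 1 := by simpa using of_polynomial (ev := ev) 1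

theorem add (hf : EvaluatesTo ev f x) (hg : EvaluatesTo ev g y) :
    EvaluatesTo ev (f + g) (x + y) := by
  obtain ⟨r, s, hs, h₁, h₂⟩ := hf
  obtain ⟨r', s', hs', h₁', h₂'⟩ := hg
  refine ⟨r * s' + r' * s, s * s', by simp [hs, hs'], ?_, ?_⟩
  · simp only [map_mul, map_add, ← h₁, ← h₁']; ring
  · simp only [map_mul, map_add, ← h₂, ← h₂']; ring

theorem neg (hf : EvaluatesTo ev f x) : EvaluatesTo ev (-f) (-x) := by
  obtain ⟨r, s, hs, h₁, h₂⟩ := hf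
  exact ⟨-r, s, hs, by simp [← h₁], by simp [← h₂]⟩

theorem sub (hf : EvaluatesTo ev f x) (hg : EvaluatesTo ev g y) :
    EvaluatesTo ev (f - g) (x - y) := by
  simpa only [sub_eq_add_neg] using hf.add hg.neg

theorem mul (hf : EvaluatesTo ev f x) (hg : EvaluatesTo ev g y) :
    EvaluatesTo ev (f * g) (x * y) := by
  obtain ⟨r, s, hs, h₁, h₂⟩ := hf
  obtain ⟨r', s', hs', h₁', h₂'⟩ := hg
  refine ⟨r * r', s * s', by simp [hs, hs'], ?_, ?_⟩
  · simp only [map_mul, ← h₁, ← h₁']; ring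
  · simp only [map_mul, ← h₂, ← h₂']; ring

theorem inv (hf : EvaluatesTo ev f x) (hx : x ≠ 0) : EvaluatesTo ev f⁻¹ x⁻¹ := by
  obtain ⟨r, s, hs, h₁, h₂⟩ := hf
  have hr : ev r ≠ 0 := by rw [← h₂]; exact mul_ne_zero hx hs
  have hr' : algebraMap _ (FF n) r ≠ 0 := fun h ↦ hr <| by
    rw [IsFractionRing.injective _ (FF n) (h.trans (map_zero _).symm), map_zero]
  have hf : f ≠ 0 := fun h ↦ hr' (by rw [← h₁, h, zero_mul])
  refine ⟨s, r, hr, ?_, ?_⟩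
  · rw [← h₁, inv_mul_cancel_left₀ hf]
  · rw [← h₂, inv_mul_cancel_left₀ hx]

theorem div (hf : EvaluatesTo ev f x) (hg : EvaluatesTo ev g y) (hy : y ≠ 0) :
    EvaluatesTo ev (f / g) (x / y) := by
  simpa only [div_eq_mul_inv] using hf.mul (hg.inv hy)

theorem prod {ι : Type*} (s : Finset ι) {f : ι → FF n} {x : ι → A}
    (h : ∀ i ∈ s, EvaluatesTo ev (f i) (x i)) :
    EvaluatesTo ev (∏ i ∈ s, f i) (∏ i ∈ s, x i) := by
  classical
  induction s using Finset.induction_on with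
  | empty => simpa using one
  | insert i s hi ih =>
    rw [Finset.prod_insert hi, Finset.prod_insert hi]
    exact (h i (by simp)).mul (ih fun j hj ↦ h j (by simp [hj]))

theorem sum {ι : Type*} (s : Finset ι) {f : ι → FF n} {x : ι → A}
    (h : ∀ i ∈ s, EvaluatesTo ev (f i) (x i)) :
    EvaluatesTo ev (∑ i ∈ s, f i) (∑ i ∈ s, x i) := by
  classical
  induction s using Finset.induction_on with
  | empty => simpa using zero
  | insert i s hi ih =>
    rw [Finset.sum_insert hi, Finset.sum_insert hi]
    exact (h i (by simp)).add (ih fun j hj ↦ h j (by simp [hj]))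

theorem pow (hf : EvaluatesTo ev f x) (k : ℕ) : EvaluatesTo ev (f ^ k) (x ^ k) := by
  simpa using prod (Finset.range k) fun _ _ ↦ hf

theorem unique (hf : EvaluatesTo ev f x) (hf' : EvaluatesTo ev f y) : x = y := by
  obtain ⟨r, s, hs, h₁, h₂⟩ := hf
  obtain ⟨r', s', hs', h₁', h₂'⟩ := hf'
  have h : r * s' = r' * s := by
    apply IsFractionRing.injective _ (FF n)
    simp only [map_mul, ← h₁, ← h₁']; ring
  have h' := congrArg ev h
  simp only [map_mul, ← h₂, ← h₂'] at h'
  exact mul_right_cancel₀ (mul_ne_zero hs hs') (by linear_combination h')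

theorem qPoch (hf : EvaluatesTo ev f x) (hg : EvaluatesTo ev g y) (k : ℕ) :
    EvaluatesTo ev (qPoch f g k) (_root_.qPoch x y k) :=
  prod _ fun j _ ↦ one.sub (hg.mul (hf.pow j))

end EvaluatesTo

end Evaluation

section Gaussian

variable {F : Type*} [Field F] {q : F}

theorem qPoch_zero (q z : F) : qPoch q z 0 = 1 := by simp [qPoch]

theorem qPoch_succ (q z : F) (k : ℕ) : qPoch q z (k + 1) = qPoch q z k * (1 - z * q ^ k) := by
  simp [qPoch, Finset.prod_range_succ]

theorem qPoch_add (q z : F) (j k : ℕ) :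
    qPoch q z (j + k) = qPoch q z j * qPoch q (z * q ^ j) k := by
  simp only [qPoch, Finset.prod_range_add]
  congr 1
  exact Finset.prod_congr rfl fun i _ ↦ by ring

theorem qPoch_pow_mul_ne_zero (hq : ∀ k : ℕ, 0 < k → q ^ k ≠ 1) (c k : ℕ) :
    qPoch q (q ^ c * q) k ≠ 0 := by
  refine Finset.prod_ne_zero_iff.mpr fun j _ h ↦ hq (c + 1 + j) (by omega) ?_
  rw [pow_add, pow_succ]
  exact (sub_eq_zero.mp h).symm

theorem qPoch_self_ne_zero (hq : ∀ k : ℕ, 0 < k → q ^ k ≠ 1) (k : ℕ) : qPoch q q k ≠ 0 := by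
  simpa using qPoch_pow_mul_ne_zero hq 0 k

/-- The Gaussian binomial coefficient `[a + b choose a]_q`. -/
def gauss (q : F) (a b : ℕ) : F := qPoch q q (a + b) / (qPoch q q a * qPoch q q b)

theorem gauss_comm (q : F) (a b : ℕ) : gauss q a b = gauss q b a := by
  rw [gauss, gauss, add_comm, mul_comm (qPoch q q a)]

theorem gauss_zero_right (hq : ∀ k : ℕ, 0 < k → q ^ k ≠ 1) (a : ℕ) : gauss q a 0 = 1 := by
  simp [gauss, qPoch_zero, qPoch_self_ne_zero hq]

theorem gauss_zero_left (hq : ∀ k : ℕ, 0 < k → q ^ k ≠ 1) (a : ℕ) : gauss q 0 a = 1 := by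
  rw [gauss_comm, gauss_zero_right hq]

theorem gauss_succ_succ (hq : ∀ k : ℕ, 0 < k → q ^ k ≠ 1) (a b : ℕ) :
    gauss q (a + 1) (b + 1) = gauss q a (b + 1) + q ^ (a + 1) * gauss q (a + 1) b := by
  have ha := qPoch_self_ne_zero hq a
  have hb := qPoch_self_ne_zero hq b
  have ha' := qPoch_self_ne_zero hq (a + 1)
  have hb' := qPoch_self_ne_zero hq (b + 1)
  simp only [gauss]
  rw [show a + 1 + (b + 1) = (a + b + 1) + 1 by ring, show a + (b + 1) = a + b + 1 by ring,
    show a + 1 + b = a + b + 1 by ring, qPoch_succ q q (a + b + 1)]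
  rw [qPoch_succ] at ha' hb'
  rw [qPoch_succ q q a, qPoch_succ q q b]
  have ha'' := right_ne_zero_of_mul ha'
  have hb'' := right_ne_zero_of_mul hb'
  field_simp
  ring

theorem qBinom_add_natCast (q : F) (x : ℤ) (m : ℕ) :
    qBinom q (x + m) m = if 0 ≤ x then gauss q x.toNat m else 0 := by
  by_cases hx : 0 ≤ x
  · lift x to ℕ using hx
    have h : ((x : ℤ) + m).toNat = x + m := by omega
    simp [qBinom, gauss, h, mul_comm]
  · simp [qBinom, hx]

theorem qBinom_natCast (q : F) (x m : ℕ) : qBinom q ((x : ℤ) + m) m = gauss q x m := by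
  simp [qBinom_add_natCast]

theorem qBinom_of_neg (q : F) {x : ℤ} (hx : x < 0) (m : ℕ) : qBinom q (x + m) m = 0 := by
  simp [qBinom_add_natCast, hx]

end Gaussian

theorem EvaluatesTo.qBinom {n : ℕ} {A : Type*} [Field A]
    {ev : MvPolynomial (Option (Fin n)) ℚ →+* A} {f : FF n} {q : A}
    (hq : ∀ k : ℕ, 0 < k → q ^ k ≠ 1) (hf : EvaluatesTo ev f q) (x y : ℤ) :
    EvaluatesTo ev (qBinom f x y) (_root_.qBinom q x y) := by
  unfold _root_.qBinom
  split_ifs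
  · exact (hf.qPoch hf _).div ((hf.qPoch hf _).mul (hf.qPoch hf _))
      (mul_ne_zero (qPoch_self_ne_zero hq _) (qPoch_self_ne_zero hq _))
  · exact .zero

section Durfee

variable {n L : ℕ} {K : Matrix (Fin n) (Fin n) ℕ} {Q a b : Fin L → Fin n → ℕ}

theorem IsDurfeeSystem.eval (hDur : IsDurfeeSystem K Q a b) (hK : ∀ i, 0 < K i i)
    {F : Type*} [Field F] [CharZero F] {q : F} (hq : ∀ k : ℕ, 0 < k → q ^ k ≠ 1)
    (c M : Fin n → ℕ) :
    (∏ i, qPoch q (q ^ c i * q) (M i))⁻¹ =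
      ∑ k : Fin L, ∑ m ∈ Fintype.piFinset fun i ↦ Finset.range (M i + 1),
        (∏ i, (q ^ c i) ^ (m i + a k i)) *
        q ^ (∑ i, (m i + a k i) * (K.mulVec m i + Q k i + b k i)) *
        (∏ i, qPoch q (q ^ c i * q) (K.mulVec m i + Q k i))⁻¹ *
        ∏ i, qBinom q ((M i : ℤ) + m i - (K.mulVec m i + Q k i : ℕ) - b k i) (m i) := by
  have h := hDur M
  have hsupp (k : Fin L) := finsum_eq_sum_of_support_subset
    (s := Fintype.piFinset fun i ↦ Finset.range (M i + 1)) (fun m : Fin n → ℕ ↦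
        (∏ i, zv n i ^ (m i + a k i)) *
        qv n ^ (∑ i, (m i + a k i) * (K.mulVec m i + Q k i + b k i)) *
        (∏ i, qPoch (qv n) (zv n i * qv n) (K.mulVec m i + Q k i))⁻¹ *
        ∏ i, qBinom (qv n) ((M i : ℤ) + m i - (K.mulVec m i + Q k i : ℕ) - b k i) (m i)) (by
      intro m hm
      rw [Function.mem_support] at hm
      have hm' := right_ne_zero_of_mul hm
      rw [Finset.prod_ne_zero_iff] at hm'
      simp only [Fintype.coe_piFinset, Finset.coe_range, Set.mem_pi, Set.mem_univ, Set.mem_Iio,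
        true_imp_iff]
      intro i
      have h₁ : m i ≤ K.mulVec m i := by
        calc m i ≤ K i i * m i := Nat.le_mul_of_pos_left _ (hK i)
          _ ≤ ∑ j, K i j * m j :=
            Finset.single_le_sum (f := fun j ↦ K i j * m j) (fun _ _ ↦ Nat.zero_le _)
              (Finset.mem_univ i)
      by_contra h₂
      apply hm' i (Finset.mem_univ i)
      rw [show (M i : ℤ) + m i - (K.mulVec m i + Q k i : ℕ) - b k i =
        ((M i : ℤ) - (K.mulVec m i + Q k i : ℕ) - b k i) + m i by ring]
      exact qBinom_of_neg _ (by push_cast; omega) _)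
  simp only [hsupp] at h
  let ev : MvPolynomial (Option (Fin n)) ℚ →+* F :=
    MvPolynomial.eval₂Hom (algebraMap ℚ F) fun o ↦ o.elim q fun i ↦ q ^ c i
  have hqv : EvaluatesTo ev (qv n) q := by
    simpa [ev, qv] using EvaluatesTo.of_polynomial (ev := ev) (.X none)
  have hzv (i : Fin n) : EvaluatesTo ev (zv n i) (q ^ c i) := by
    simpa [ev, zv] using EvaluatesTo.of_polynomial (ev := ev) (.X (some i))
  have hne (N : Fin n → ℕ) : ∏ i, qPoch q (q ^ c i * q) (N i) ≠ 0 :=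
    Finset.prod_ne_zero_iff.mpr fun i _ ↦ qPoch_pow_mul_ne_zero hq _ _
  have hpoch (N : Fin n → ℕ) := (EvaluatesTo.prod Finset.univ fun i _ ↦
    hqv.qPoch ((hzv i).mul hqv) (N i)).inv (hne N)
  refine (h ▸ hpoch M).unique ?_
  refine .sum _ fun k _ ↦ .sum _ fun m _ ↦ .mul (.mul (.mul ?_ (hqv.pow _)) (hpoch _)) ?_
  · exact .prod _ fun i _ ↦ (hzv i).pow _
  · exact .prod _ fun i _ ↦ hqv.qBinom hq _ _

end Durfee

section Truncated

variable {F : Type*} [Field F] {q : F}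

/-- The Gaussian binomial coefficient `[M - t + m choose m]_q`, set to zero when `M < t`. -/
def gaussSub (q : F) (M t m : ℕ) : F := if t ≤ M then gauss q (M - t) m else 0

theorem gaussSub_of_le {M t : ℕ} (h : t ≤ M) (m : ℕ) : gaussSub q M t m = gauss q (M - t) m :=
  if_pos h

theorem gaussSub_of_lt {M t : ℕ} (h : M < t) (m : ℕ) : gaussSub q M t m = 0 :=
  if_neg (by omega)

theorem gaussSub_add_add (M t s m : ℕ) : gaussSub q (M + s) (t + s) m = gaussSub q M t m := by
  simp [gaussSub, Nat.add_sub_add_right]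

theorem gaussSub_zero (hq : ∀ k : ℕ, 0 < k → q ^ k ≠ 1) (M t : ℕ) :
    gaussSub q M t 0 = if t ≤ M then 1 else 0 := by
  simp [gaussSub, gauss_zero_right hq]

theorem gaussSub_succ_succ (hq : ∀ k : ℕ, 0 < k → q ^ k ≠ 1) (M t m : ℕ) :
    gaussSub q (M + 1) t (m + 1) =
      gaussSub q M t (m + 1) + q ^ (M + 1 - t) * gaussSub q (M + 1) t m := by
  rcases lt_trichotomy t (M + 1) with h | rfl | h
  · rw [gaussSub_of_le (by omega), gaussSub_of_le (by omega), gaussSub_of_le (by omega),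
      Nat.sub_add_comm (by omega), gauss_succ_succ hq]
  · simp [gaussSub, gauss_zero_left hq]
  · rw [gaussSub_of_lt h, gaussSub_of_lt (by omega), gaussSub_of_lt h]; simp

theorem sum_pow_mul_gaussSub (hq : ∀ k : ℕ, 0 < k → q ^ k ≠ 1) (M t m : ℕ) :
    ∑ l ∈ Finset.range (M + 1), q ^ l * gaussSub q l t m = q ^ t * gaussSub q M t (m + 1) := by
  induction M with
  | zero =>
    rcases Nat.eq_zero_or_pos t with rfl | h
    · simp [gaussSub, gauss_zero_left hq]
    · simp [gaussSub_of_lt h]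
  | succ M ih =>
    rw [Finset.sum_range_succ, ih, gaussSub_succ_succ hq]
    by_cases h : t ≤ M + 1
    · rw [mul_add, ← mul_assoc (q ^ t), ← pow_add, Nat.add_sub_cancel' h]
    · simp [gaussSub_of_lt (not_le.mp h)]

theorem qBinom_sub_eq_gaussSub (q : F) (M t m : ℕ) :
    qBinom q ((M : ℤ) - t + m) m = gaussSub q M t m := by
  rw [qBinom_add_natCast]
  by_cases h : t ≤ M
  · rw [gaussSub_of_le h, if_pos (by omega)]; congr 1; omega
  · rw [gaussSub_of_lt (by omega), if_neg (by omega)]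

end Truncated

section Summands

variable {F : Type*} [Field F] {q : F}

/-- The function `(M, c) ↦ 1 / (z q; q)_M` at `z = q ^ c`. -/
def invPoch (q : F) (x : ℕ × ℕ) : F := (qPoch q (q ^ x.2 * q) x.1)⁻¹

/-- The one-dimensional summand of a Durfee system at `z = q ^ c`, as a function of `(M, c)`. -/
def durfeeSum (q : F) (κ Q a b : ℕ) (x : ℕ × ℕ) : F :=
  ∑ m ∈ Finset.range (x.1 + 1), (q ^ x.2) ^ (m + a) * q ^ ((m + a) * (κ * m + Q + b)) *
    invPoch q (κ * m + Q, x.2) * gaussSub q x.1 (κ * m + Q + b) m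

theorem lt_mul_add_of_lt {κ M m : ℕ} (hκ : 0 < κ) (hm : M < m) (t : ℕ) : M < κ * m + t :=
  hm.trans_le ((Nat.le_mul_of_pos_left m hκ).trans (Nat.le_add_right _ _))

theorem sum_range_gaussSub_eq {κ M R : ℕ} (hκ : 0 < κ) (hR : M < R) (f : ℕ → F) (t : ℕ) :
    ∑ m ∈ Finset.range R, f m * gaussSub q M (κ * m + t) m =
      ∑ m ∈ Finset.range (M + 1), f m * gaussSub q M (κ * m + t) m := by
  refine (Finset.sum_subset (by simpa using hR) fun m _ hm ↦ ?_).symm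
  rw [gaussSub_of_lt (lt_mul_add_of_lt hκ (by simpa using hm) t), mul_zero]

end Summands

section CoefficientFunctional

open Polynomial

variable {F : Type*} [Field F] {q : F}

/-- The linear functional sending `p` to the coefficient of `X ^ J` in
`p(q ^ c X) · ∑ j, [M + c + j choose j]_q X ^ j`. -/
def gaussFunctional (q : F) (c J M : ℕ) : F[X] →ₗ[F] F :=
  ∑ y ∈ Finset.range (J + 1), (q ^ (c * y) * gauss q (M + c) (J - y)) • lcoeff F y

theorem gaussFunctional_X_pow (c J M y : ℕ) :
    gaussFunctional q c J M (X ^ y) =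
      if y ≤ J then q ^ (c * y) * gauss q (M + c) (J - y) else 0 := by
  simp [gaussFunctional, coeff_X_pow]

theorem gaussFunctional_mul (hq : ∀ k : ℕ, 0 < k → q ^ k ≠ 1) (c J M : ℕ) (p : F[X]) :
    gaussFunctional q c J (M + 1) (p * (1 - C (q ^ (M + 1)) * X)) =
      gaussFunctional q c J M p := by
  induction p using Polynomial.induction_on' with
  | add p r hp hr => rw [add_mul, map_add, map_add, hp, hr]
  | monomial y x =>
    have h : monomial y x * (1 - C (q ^ (M + 1)) * X) =
        x • (X ^ y : F[X]) - (x * q ^ (M + 1)) • X ^ (y + 1) := by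
      simp only [← C_mul_X_pow_eq_monomial, smul_eq_C_mul, C_mul]; ring
    rw [h, ← C_mul_X_pow_eq_monomial, ← smul_eq_C_mul, map_sub, map_smul, map_smul, map_smul,
      gaussFunctional_X_pow, gaussFunctional_X_pow, gaussFunctional_X_pow]
    simp only [smul_eq_mul]
    rcases lt_trichotomy y J with hy | rfl | hy
    · obtain ⟨d, rfl⟩ := Nat.exists_eq_add_of_lt hy
      rw [if_pos (by omega), if_pos (by omega), if_pos (by omega),
        show y + d + 1 - y = d + 1 by omega, show y + d + 1 - (y + 1) = d by omega,
        show M + 1 + c = M + c + 1 by omega, gauss_succ_succ hq]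
      ring
    · simp [gauss_zero_right hq]
    · rw [if_neg (by omega), if_neg (by omega), if_neg (by omega)]; simp

theorem gaussFunctional_mul_prod (hq : ∀ k : ℕ, 0 < k → q ^ k ≠ 1) (c J P d : ℕ) (p : F[X]) :
    gaussFunctional q c J (P + d) (p * ∏ k ∈ Finset.range d, (1 - C (q ^ (P + k + 1)) * X)) =
      gaussFunctional q c J P p := by
  induction d with
  | zero => simp
  | succ d ih => rw [Finset.prod_range_succ, ← mul_assoc, ← add_assoc, gaussFunctional_mul hq, ih]

end CoefficientFunctional

section Weights

open Polynomial Finsupp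

variable {F : Type*} [Field F] {q : F}

theorem pow_injective_of_pow_ne_one (h₀ : q ≠ 0) (hq : ∀ k : ℕ, 0 < k → q ^ k ≠ 1) :
    Function.Injective fun c : ℕ ↦ q ^ c := by
  intro c d h
  wlog hcd : c ≤ d generalizing c d
  · exact (this h.symm (by omega)).symm
  obtain ⟨e, rfl⟩ := Nat.exists_eq_add_of_le hcd
  rcases Nat.eq_zero_or_pos e with rfl | he
  · rfl
  · refine absurd ?_ (hq e he)
    simp only [pow_add] at h
    exact mul_left_cancel₀ (pow_ne_zero c h₀) (by rw [← h, mul_one])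

theorem exists_forall_eq_sum_eval_pow (h₀ : q ≠ 0) (hq : ∀ k : ℕ, 0 < k → q ^ k ≠ 1)
    (l : F[X] →ₗ[F] F) (d : ℕ) :
    ∃ α : ℕ → F, ∀ p : F[X], p.natDegree < d →
      l p = ∑ c ∈ Finset.range d, α c * p.eval (q ^ c) := by
  refine ⟨fun c ↦ l (Lagrange.basis (Finset.range d) (fun c ↦ q ^ c) c), fun p hp ↦ ?_⟩
  have h := Lagrange.eq_interpolate (s := Finset.range d) (f := p)
    (pow_injective_of_pow_ne_one h₀ hq).injOn
    (degree_le_natDegree.trans_lt (by simpa using hp))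
  conv_lhs => rw [h, Lagrange.interpolate_apply, map_sum]
  refine Finset.sum_congr rfl fun c _ ↦ ?_
  rw [← smul_eq_C_mul, map_smul, smul_eq_mul, mul_comm]

theorem eval_prod_one_sub (hq : ∀ k : ℕ, 0 < k → q ^ k ≠ 1) (P d c : ℕ) :
    (∏ k ∈ Finset.range d, (1 - C (q ^ (P + k + 1)) * X)).eval (q ^ c) =
      qPoch q (q ^ c * q) (P + d) * invPoch q (P, c) := by
  rw [qPoch_add, invPoch, mul_comm, inv_mul_cancel_left₀ (qPoch_pow_mul_ne_zero hq c P),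
    eval_prod, qPoch]
  refine Finset.prod_congr rfl fun k _ ↦ ?_
  simp only [eval_sub, eval_one, eval_mul, eval_C, eval_X]
  ring

/-- A combination of the points `(M, c')` whose value on `invPoch` is `[M + c + J choose J]_q`,
together with its value on the Durfee summands. -/
theorem exists_weights_gauss (h₀ : q ≠ 0) (hq : ∀ k : ℕ, 0 < k → q ^ k ≠ 1) {κ : ℕ}
    (A c J M : ℕ) :
    ∃ w : ℕ × ℕ →₀ F, linearCombination F (invPoch q) w = gauss q (M + c) J ∧
      ∀ Q a b : ℕ, a ≤ A → linearCombination F (durfeeSum q κ Q a b) w =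
        ∑ m ∈ Finset.range (M + 1), q ^ ((m + a) * (κ * m + Q + b + c)) *
          gaussSub q J (m + a) (κ * m + Q + c) * gaussSub q M (κ * m + Q + b) m := by
  obtain ⟨α, hα⟩ := exists_forall_eq_sum_eval_pow h₀ hq (gaussFunctional q c J M) (2 * M + A + 1)
  refine ⟨∑ c' ∈ Finset.range (2 * M + A + 1), single (M, c') (α c' * qPoch q (q ^ c' * q) M),
    ?_, fun Q a b ha ↦ ?_⟩
  · have h := hα 1 (by simp)
    have h' := gaussFunctional_X_pow (q := q) c J M 0
    simp only [pow_zero, zero_le, if_true, mul_zero, one_mul, Nat.sub_zero, eval_one, mul_one]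
      at h h'
    simp only [map_sum, linearCombination_single, smul_eq_mul, invPoch]
    rw [← h', h]
    exact Finset.sum_congr rfl fun c' _ ↦ mul_inv_cancel_right₀ (qPoch_pow_mul_ne_zero hq c' M) _
  · simp only [map_sum, linearCombination_single, smul_eq_mul, durfeeSum, Finset.mul_sum]
    rw [Finset.sum_comm]
    refine Finset.sum_congr rfl fun m hm ↦ ?_
    by_cases hP : κ * m + Q + b ≤ M
    swap
    · simp [gaussSub_of_lt (not_le.mp hP)]
    obtain ⟨d, hd⟩ := Nat.exists_eq_add_of_le (show κ * m + Q ≤ M by omega)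
    set P := κ * m + Q
    have hdeg : (X ^ (m + a) * ∏ k ∈ Finset.range d,
        (1 - C (q ^ (P + k + 1)) * X)).natDegree < 2 * M + A + 1 := by
      have h₁ : (∏ k ∈ Finset.range d, (1 - C (q ^ (P + k + 1)) * X)).natDegree ≤ d := by
        refine (natDegree_prod_le _ _).trans ((Finset.sum_le_card_nsmul _ _ 1 fun k _ ↦ ?_).trans
          (by simp))
        compute_degree
      have h₂ := natDegree_mul_le (p := (X ^ (m + a) : F[X]))
        (q := ∏ k ∈ Finset.range d, (1 - C (q ^ (P + k + 1)) * X))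
      have h₃ : m ≤ M := by simpa [Nat.lt_succ_iff] using hm
      simp only [natDegree_X_pow] at h₂
      omega
    have key := hα _ hdeg
    rw [hd, gaussFunctional_mul_prod hq, gaussFunctional_X_pow, ← hd] at key
    simp only [eval_mul, eval_pow, eval_X, eval_prod_one_sub hq, ← hd] at key
    have hJ : (if m + a ≤ J then q ^ (c * (m + a)) * gauss q (P + c) (J - (m + a)) else 0) =
        q ^ (c * (m + a)) * gaussSub q J (m + a) (P + c) := by
      rw [gaussSub, gauss_comm]; split_ifs <;> simp
    rw [hJ] at key
    rw [mul_add (m + a) (P + b), pow_add, mul_comm (m + a) c, mul_assoc (q ^ ((m + a) * (P + b))),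
      key, Finset.mul_sum, Finset.sum_mul]
    exact Finset.sum_congr rfl fun c' _ ↦ by ring

theorem exists_weights_gaussSub (h₀ : q ≠ 0) (hq : ∀ k : ℕ, 0 < k → q ^ k ≠ 1) {κ : ℕ}
    (hκ : 0 < κ) (A N R e M : ℕ) (hR : M < R) :
    ∃ w : ℕ × ℕ →₀ F, linearCombination F (invPoch q) w = gaussSub q M 0 (N + e) ∧
      ∀ Q a b : ℕ, a ≤ A → linearCombination F (durfeeSum q κ Q a b) w =
        ∑ r ∈ Finset.range R, q ^ ((r + e + a) * (κ * r + Q + b)) *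
          gaussSub q N (r + a) (κ * r + Q) * gaussSub q M (κ * r + Q + b) (r + e) := by
  induction e generalizing M with
  | zero =>
    obtain ⟨w, h₁, h₂⟩ := exists_weights_gauss h₀ hq (κ := κ) A 0 N M
    refine ⟨w, ?_, fun Q a b ha ↦ ?_⟩
    · rw [h₁, gaussSub_of_le (Nat.zero_le _)]; simp
    · rw [h₂ Q a b ha]
      simp only [add_zero, add_assoc]
      rw [sum_range_gaussSub_eq hκ hR]
  | succ e ih =>
    have h (l : ℕ) (hl : l < M + 1) := ih l (by omega)
    choose! w h₁ h₂ using h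
    refine ⟨∑ l ∈ Finset.range (M + 1), q ^ l • w l, ?_, fun Q a b ha ↦ ?_⟩
    · simp only [map_sum, map_smul, smul_eq_mul]
      rw [Finset.sum_congr rfl fun l hl ↦ by rw [h₁ l (Finset.mem_range.mp hl)],
        sum_pow_mul_gaussSub hq, pow_zero, one_mul, add_assoc]
    · simp only [map_sum, map_smul, smul_eq_mul]
      rw [Finset.sum_congr rfl fun l hl ↦ by
        rw [h₂ l (Finset.mem_range.mp hl) Q a b ha, Finset.mul_sum], Finset.sum_comm]
      refine Finset.sum_congr rfl fun r _ ↦ ?_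
      rw [show (r + (e + 1) + a) * (κ * r + Q + b) =
          (r + e + a) * (κ * r + Q + b) + (κ * r + Q + b) by ring, pow_add, ← add_assoc r,
        mul_right_comm _ (q ^ (κ * r + Q + b)), mul_assoc, ← sum_pow_mul_gaussSub hq,
        Finset.mul_sum]
      exact Finset.sum_congr rfl fun l _ ↦ by ring

end Weights

section Coordinate

open Finsupp

variable {F : Type*} [Field F] {q : F}

/-- The product of the `m`-th and `(κ r + Q)`-th summands of the two one-dimensional partition
functions, without the factor depending only on `r - m`. -/
def ucpfTerm (q : F) (κ Q a b M N m r : ℕ) : F :=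
  q ^ ((m + a) * (κ * r + Q + b)) * gaussSub q N (r + a) (κ * r + Q) *
    gaussSub q M (κ * m + Q + b) m

theorem ucpfTerm_of_lt_left {κ M m : ℕ} (hκ : 0 < κ) (hm : M < m) (Q a b N r : ℕ) :
    ucpfTerm q κ Q a b M N m r = 0 := by
  rw [ucpfTerm, gaussSub_of_lt (t := κ * m + Q + b), mul_zero]
  rw [add_assoc]
  exact lt_mul_add_of_lt hκ hm _

theorem ucpfTerm_of_lt_right {N r : ℕ} (hr : N < r) (κ Q a b M m : ℕ) :
    ucpfTerm q κ Q a b M N m r = 0 := by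
  rw [ucpfTerm, gaussSub_of_lt (M := N) (by omega), mul_zero, zero_mul]

theorem exists_weights_fiber (h₀ : q ≠ 0) (hq : ∀ k : ℕ, 0 < k → q ^ k ≠ 1) {κ : ℕ}
    (hκ : 0 < κ) (A M N : ℕ) (s : ℤ) (hs : s ∈ Finset.Icc (-M : ℤ) N) :
    ∃ w : ℕ × ℕ →₀ F,
      linearCombination F (invPoch q) w = qBinom q (M + N + κ * s - s) (M + κ * s) ∧
      ∀ Q a b : ℕ, a ≤ A → linearCombination F (durfeeSum q κ Q a b) w =
        ∑ m ∈ Finset.range (M + 1), ∑ r ∈ Finset.range (N + 1),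
          if (r : ℤ) - m = s then ucpfTerm q κ Q a b M N m r else 0 := by
  rw [Finset.mem_Icc] at hs
  rcases le_or_gt 0 s with h | h
  · lift s to ℕ using h
    obtain ⟨N, rfl⟩ := Nat.exists_eq_add_of_le (show s ≤ N by omega)
    obtain ⟨w, h₁, h₂⟩ := exists_weights_gauss h₀ hq (κ := κ) A (κ * s) N M
    refine ⟨w, ?_, fun Q a b ha ↦ ?_⟩
    · rw [h₁, gauss_comm, ← qBinom_natCast]
      push_cast
      congr 1; ring
    · rw [h₂ Q a b ha]
      refine Finset.sum_congr rfl fun m _ ↦ ?_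
      rw [Finset.sum_congr rfl fun (r : ℕ) _ ↦ if_congr (show (r : ℤ) - m = s ↔ r = m + s by omega)
        rfl rfl, Finset.sum_ite_eq']
      split_ifs with hm
      · rw [ucpfTerm, add_comm s N, add_right_comm m s a, gaussSub_add_add, mul_add κ m s,
          add_right_comm (κ * m) (κ * s) Q, add_right_comm _ (κ * s) b]
      · rw [gaussSub_of_lt (M := N) (by simp at hm; omega)]; simp
  · obtain ⟨e, rfl⟩ : ∃ e : ℕ, s = -e := ⟨s.natAbs, by omega⟩
    have hcoe (Q a b : ℕ) (R : ℕ) (hR : N < R) :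
        ∑ m ∈ Finset.range (M + 1), ∑ r ∈ Finset.range (N + 1),
          (if (r : ℤ) - m = -e then ucpfTerm q κ Q a b M N m r else 0) =
        ∑ r ∈ Finset.range R, ucpfTerm q κ Q a b M N (r + e) r := by
      rw [Finset.sum_comm]
      trans ∑ r ∈ Finset.range (N + 1), ucpfTerm q κ Q a b M N (r + e) r
      · refine Finset.sum_congr rfl fun r _ ↦ ?_
        rw [Finset.sum_congr rfl fun (m : ℕ) _ ↦ if_congr
          (show (r : ℤ) - m = -e ↔ m = r + e by omega) rfl rfl, Finset.sum_ite_eq']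
        split_ifs with hm
        · rfl
        · rw [ucpfTerm_of_lt_left hκ (by simpa using hm)]
      · refine Finset.sum_subset (by simpa using hR) fun r _ hr ↦ ?_
        rw [ucpfTerm_of_lt_right (by simpa using hr)]
    by_cases he : κ * e ≤ M
    · obtain ⟨M', rfl⟩ := Nat.exists_eq_add_of_le' he
      obtain ⟨w, h₁, h₂⟩ := exists_weights_gaussSub h₀ hq hκ A N (M' + N + 1) e M' (by omega)
      refine ⟨w, ?_, fun Q a b ha ↦ ?_⟩
      · rw [h₁, gaussSub_of_le (Nat.zero_le _), Nat.sub_zero, gauss_comm, ← qBinom_natCast]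
        push_cast
        congr 1 <;> ring
      · rw [h₂ Q a b ha, hcoe _ _ _ (M' + N + 1) (by omega)]
        refine Finset.sum_congr rfl fun r _ ↦ ?_
        rw [ucpfTerm, mul_add κ r e, add_right_comm (κ * r) (κ * e) Q,
          add_right_comm _ (κ * e) b, gaussSub_add_add]
    · refine ⟨0, ?_, fun Q a b ha ↦ ?_⟩
      · rw [map_zero, qBinom, if_neg]
        have : (M : ℤ) < κ * e := by exact_mod_cast not_le.mp he
        rintro ⟨h₁, -⟩
        linarith
      · rw [map_zero, hcoe _ _ _ (N + 1) (by omega), Finset.sum_eq_zero]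
        intro r _
        rw [ucpfTerm, gaussSub_of_lt (M := M), mul_zero]
        have : κ * e ≤ κ * (r + e) := Nat.mul_le_mul_left _ (by omega)
        omega

/-- The one-dimensional bilinear identity, as a linear combination of Durfee identities. -/
theorem exists_weights (h₀ : q ≠ 0) (hq : ∀ k : ℕ, 0 < k → q ^ k ≠ 1) {κ : ℕ}
    (hκ : 0 < κ) (A M N : ℕ) (C : ℤ → F) :
    ∃ w : ℕ × ℕ →₀ F,
      linearCombination F (invPoch q) w =
        ∑ s ∈ Finset.Icc (-M : ℤ) N, C s * qBinom q (M + N + κ * s - s) (M + κ * s) ∧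
      ∀ Q a b : ℕ, a ≤ A → linearCombination F (durfeeSum q κ Q a b) w =
        ∑ m ∈ Finset.range (M + 1), ∑ r ∈ Finset.range (N + 1),
          C (r - m) * ucpfTerm q κ Q a b M N m r := by
  have h := exists_weights_fiber h₀ hq hκ A M N
  choose! w h₁ h₂ using h
  refine ⟨∑ s ∈ Finset.Icc (-M : ℤ) N, C s • w s, ?_, fun Q a b ha ↦ ?_⟩
  · simp only [map_sum, map_smul, smul_eq_mul]
    exact Finset.sum_congr rfl fun s hs ↦ by rw [h₁ s hs]
  · simp only [map_sum, map_smul, smul_eq_mul]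
    rw [Finset.sum_congr rfl fun s hs ↦ by rw [h₂ s hs Q a b ha]]
    simp only [Finset.mul_sum, mul_ite, mul_zero]
    rw [Finset.sum_comm]
    refine Finset.sum_congr rfl fun m hm ↦ ?_
    rw [Finset.sum_comm]
    refine Finset.sum_congr rfl fun r hr ↦ ?_
    rw [Finset.sum_ite_eq, if_pos]
    simp only [Finset.mem_range, Finset.mem_Icc] at *
    omega

end Coordinate

section Tensor

open Finsupp

theorem prod_linearCombination {ι κ X F : Type*} [Fintype ι] [DecidableEq ι] [Fintype κ] [Field F]
    {φ : X → F} {γ : κ → ι → X → F} (h : ∀ x : ι → X, ∏ i, φ (x i) = ∑ k, ∏ i, γ k i (x i))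
    (w : ι → X →₀ F) :
    ∏ i, linearCombination F φ (w i) = ∑ k, ∏ i, linearCombination F (γ k i) (w i) := by
  simp only [linearCombination_apply, Finsupp.sum, smul_eq_mul, Finset.prod_univ_sum,
    Finset.prod_mul_distrib, h, Finset.mul_sum]
  exact Finset.sum_comm

end Tensor

section Positivity

theorem pow_ne_one_of_lt_one {q : ℚ} (h₀ : 0 < q) (h₁ : q < 1) (k : ℕ) (hk : 0 < k) :
    q ^ k ≠ 1 :=
  (pow_lt_one₀ h₀.le h₁ hk.ne').ne

theorem qPoch_pow_mul_pos {q : ℚ} (h₀ : 0 < q) (h₁ : q < 1) (c k : ℕ) :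
    0 < qPoch q (q ^ c * q) k := by
  refine Finset.prod_pos fun j _ ↦ ?_
  rw [← pow_succ, ← pow_add, sub_pos]
  exact pow_lt_one₀ h₀.le h₁ (by omega)

theorem gaussSub_nonneg {q : ℚ} (h₀ : 0 < q) (h₁ : q < 1) (M t m : ℕ) : 0 ≤ gaussSub q M t m := by
  have h (k : ℕ) : 0 < qPoch q q k := by simpa using qPoch_pow_mul_pos h₀ h₁ 0 k
  rw [gaussSub]
  split_ifs
  · exact (div_pos (h _) (mul_pos (h _) (h _))).le
  · rfl

theorem invPoch_pos {q : ℚ} (h₀ : 0 < q) (h₁ : q < 1) (x : ℕ × ℕ) : 0 < invPoch q x :=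
  inv_pos.mpr (qPoch_pow_mul_pos h₀ h₁ _ _)

theorem durfeeSum_term_nonneg {q : ℚ} (h₀ : 0 < q) (h₁ : q < 1) (κ Q a b : ℕ) (x : ℕ × ℕ)
    (m : ℕ) : 0 ≤ (q ^ x.2) ^ (m + a) * q ^ ((m + a) * (κ * m + Q + b)) *
      invPoch q (κ * m + Q, x.2) * gaussSub q x.1 (κ * m + Q + b) m :=
  mul_nonneg (mul_pos (by positivity) (invPoch_pos h₀ h₁ _)).le (gaussSub_nonneg h₀ h₁ _ _ _)

theorem durfeeSum_nonneg {q : ℚ} (h₀ : 0 < q) (h₁ : q < 1) (κ Q a b : ℕ) (x : ℕ × ℕ) :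
    0 ≤ durfeeSum q κ Q a b x :=
  Finset.sum_nonneg fun m _ ↦ durfeeSum_term_nonneg h₀ h₁ κ Q a b x m

theorem durfeeSum_pos {q : ℚ} (h₀ : 0 < q) (h₁ : q < 1) (κ Q a b : ℕ) :
    0 < durfeeSum q κ Q a b (Q + b, 0) := by
  refine Finset.sum_pos' (fun m _ ↦ durfeeSum_term_nonneg h₀ h₁ κ Q a b _ m) ⟨0, by simp, ?_⟩
  refine mul_pos (mul_pos (by positivity) (invPoch_pos h₀ h₁ _)) ?_
  simp [gaussSub_zero (pow_ne_one_of_lt_one h₀ h₁)]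

end Positivity

section Residue

variable {F : Type*} [Field F] {q : F}

theorem invPoch_sub (hq : ∀ k : ℕ, 0 < k → q ^ k ≠ 1) {κ M T : ℕ} (hT : M + κ = T + 1) :
    invPoch q (T + 1, 0) - invPoch q (T, 0) -
      q ^ (T + 1) * invPoch q (κ, 0) * invPoch q (M, κ) = 0 := by
  have h₁ := qPoch_pow_mul_ne_zero hq 0 (T + 1)
  have h₂ : qPoch q (q ^ 0 * q) (T + 1) = qPoch q (q ^ 0 * q) κ * qPoch q (q ^ κ * q) M := by
    rw [← hT, add_comm, qPoch_add, pow_zero, one_mul, mul_comm q]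
  have h₃ : invPoch q (κ, 0) * invPoch q (M, κ) = invPoch q (T + 1, 0) := by
    simp only [invPoch, h₂, mul_inv]
  rw [mul_assoc, h₃]
  simp only [invPoch, qPoch_succ, pow_zero, one_mul] at h₁ ⊢
  have h₄ := left_ne_zero_of_mul h₁
  have h₅ := right_ne_zero_of_mul h₁
  rw [mul_inv]
  field_simp
  ring

theorem invPoch_mul (q : F) (κ P : ℕ) :
    invPoch q (κ, 0) * invPoch q (P, κ) = invPoch q (κ + P, 0) := by
  simp only [invPoch, qPoch_add, mul_inv, pow_zero, one_mul, mul_comm q]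

theorem durfeeSum_sub (hq : ∀ k : ℕ, 0 < k → q ^ k ≠ 1) {κ M T : ℕ} (hκ : 0 < κ)
    (hT : M + κ = T + 1) (Q a b : ℕ) :
    durfeeSum q κ Q a b (T + 1, 0) - durfeeSum q κ Q a b (T, 0) -
      q ^ (T + 1) * invPoch q (κ, 0) * durfeeSum q κ Q a b (M, κ) =
      if Q + b = T + 1 then q ^ (a * (Q + b)) * invPoch q (Q, 0) else 0 := by
  simp only [durfeeSum, add_assoc (κ * _) Q b]
  rw [← sum_range_gaussSub_eq hκ (show T < T + 1 + 1 by omega),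
    ← sum_range_gaussSub_eq hκ (show M < T + 1 by omega), Finset.sum_range_succ' _ (T + 1),
    Finset.sum_range_succ' _ (T + 1), Finset.mul_sum, add_sub_add_comm, add_sub_right_comm,
    ← Finset.sum_sub_distrib, ← Finset.sum_sub_distrib, Finset.sum_eq_zero, zero_add]
  · simp only [gaussSub_zero hq, mul_zero, zero_add, pow_zero, one_pow, one_mul]
    by_cases h : Q + b = T + 1
    · simp [h]
    · by_cases h' : Q + b ≤ T
      · simp [h, h', h'.trans (Nat.le_succ T)]
      · simp [h, h', show ¬ Q + b ≤ T + 1 by omega]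
  · intro m _
    rw [gaussSub_succ_succ hq, show κ * (m + 1) + (Q + b) = κ * m + (Q + b) + κ by ring, ← hT,
      gaussSub_add_add, hT, show κ * (m + 1) + Q = κ + (κ * m + Q) by ring, ← invPoch_mul]
    by_cases h : κ * m + (Q + b) ≤ M
    · have h' : q ^ (T + 1) = q ^ (T + 1 - (κ * m + (Q + b) + κ)) * q ^ (κ * m + (Q + b) + κ) := by
        rw [← pow_add]; congr 1; omega
      rw [h']
      ring
    · simp [gaussSub_of_lt (not_le.mp h)]

end Residue

section Diagonal

open Finsupp (linearCombination linearCombination_single)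

variable {n L : ℕ} {K : Matrix (Fin n) (Fin n) ℕ} {Q a b : Fin L → Fin n → ℕ}

theorem half_pow_ne_one (k : ℕ) (hk : 0 < k) : (1 / 2 : ℚ) ^ k ≠ 1 :=
  pow_ne_one_of_lt_one (by norm_num) (by norm_num) k hk

theorem eq_zero_of_mulVec_single_le (hK : ∀ i, 0 < K i i) {i j : Fin n} (hij : i ≠ j)
    (hKij : 0 < K i j) {t : ℕ} {m : Fin n → ℕ}
    (h : ∀ l, K.mulVec m l ≤ (Pi.single j t : Fin n → ℕ) l) : m = 0 := by
  have hle (l l' : Fin n) : K l l' * m l' ≤ K.mulVec m l :=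
    Finset.single_le_sum (f := fun j ↦ K l j * m j) (fun _ _ ↦ Nat.zero_le _) (Finset.mem_univ l')
  have hj {l : Fin n} (hl : l ≠ j) (l' : Fin n) : K l l' * m l' = 0 := by
    have := (hle l l').trans (h l)
    rwa [Pi.single_eq_of_ne hl, Nat.le_zero] at this
  funext l
  by_cases hl : l = j
  · subst hl
    exact (mul_eq_zero.mp (hj hij l)).resolve_left hKij.ne'
  · exact (mul_eq_zero.mp (hj hl l)).resolve_left (hK l).ne'

/-- A matrix with positive diagonal that admits a Durfee system is diagonal. -/
theorem IsDurfeeSystem.eq_zero_of_ne (hDur : IsDurfeeSystem K Q a b) (hK : ∀ i, 0 < K i i)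
    {i j : Fin n} (hij : i ≠ j) : K i j = 0 := by
  by_contra hKij
  have hsum (t : ℕ) : (qPoch (1 / 2 : ℚ) (1 / 2) t)⁻¹ = ∑ k : Fin L,
      (1 / 2 : ℚ) ^ (∑ i, a k i * (Q k i + b k i)) *
        (∏ i, qPoch (1 / 2 : ℚ) (1 / 2) (Q k i))⁻¹ *
        ∏ l, qBinom (1 / 2 : ℚ) (((Pi.single j t : Fin n → ℕ) l : ℤ) - Q k l - b k l) 0 := by
    have h := hDur.eval hK half_pow_ne_one 0 (Pi.single j t)
    rw [Finset.prod_eq_single j (fun l _ hl ↦ by simp [Pi.single_eq_of_ne hl, qPoch_zero])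
      (by simp)] at h
    simp only [Pi.single_eq_same, Pi.zero_apply, pow_zero, one_mul] at h
    rw [h]
    refine Finset.sum_congr rfl fun k _ ↦ ?_
    rw [Finset.sum_eq_single 0]
    · simp
    · intro m _ hm
      obtain ⟨l, hl⟩ := not_forall.mp
        (mt (eq_zero_of_mulVec_single_le (t := t) hK hij (Nat.pos_of_ne_zero hKij)) hm)
      refine mul_eq_zero_of_right _ (Finset.prod_eq_zero (Finset.mem_univ l) ?_)
      rw [add_sub_right_comm, add_sub_right_comm]
      exact qBinom_of_neg _ (by push_cast; omega) _
    · intro hm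
      simp at hm
  set T := ∑ k, (Q k j + b k j)
  have hT (k : Fin L) : Q k j + b k j ≤ T :=
    Finset.single_le_sum (f := fun k ↦ Q k j + b k j) (fun _ _ ↦ Nat.zero_le _) (Finset.mem_univ k)
  have hbin (k : Fin L) (l : Fin n) :
      qBinom (1 / 2 : ℚ) (((Pi.single j (T + 1) : Fin n → ℕ) l : ℤ) - Q k l - b k l) 0 =
      qBinom (1 / 2 : ℚ) (((Pi.single j T : Fin n → ℕ) l : ℤ) - Q k l - b k l) 0 := by
    by_cases hl : l = j
    · subst hl
      have h := qBinom_add_natCast (1 / 2 : ℚ) (m := 0)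
      simp only [Nat.cast_zero, add_zero, gauss_zero_right half_pow_ne_one] at h
      have := hT k
      rw [h, h, if_pos, if_pos] <;> simp <;> omega
    · simp [Pi.single_eq_of_ne hl]
  have h := (hsum (T + 1)).trans ((Finset.sum_congr rfl fun k _ ↦ by simp only [hbin]).trans
    (hsum T).symm)
  rw [_root_.inv_inj, qPoch_succ] at h
  have h' := mul_right_eq_self₀.mp h
  have h₀ : (1 / 2 : ℚ) * (1 / 2) ^ T ≠ 0 := by positivity
  rcases h' with h' | h'
  · exact h₀ (by linarith)
  · exact qPoch_self_ne_zero half_pow_ne_one T h'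

theorem IsDurfeeSystem.prod_invPoch (hDur : IsDurfeeSystem K Q a b) (hK : ∀ i, 0 < K i i)
    {F : Type*} [Field F] [CharZero F] {q : F} (hq : ∀ k : ℕ, 0 < k → q ^ k ≠ 1)
    (x : Fin n → ℕ × ℕ) :
    ∏ i, invPoch q (x i) =
      ∑ k : Fin L, ∏ i, durfeeSum q (K i i) (Q k i) (a k i) (b k i) (x i) := by
  have hdiag (m : Fin n → ℕ) (i : Fin n) : K.mulVec m i = K i i * m i :=
    Finset.sum_eq_single (s := Finset.univ) (f := fun j ↦ K i j * m j) i
      (fun j _ hj ↦ by simp [hDur.eq_zero_of_ne hK hj.symm]) (by simp)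
  have h := hDur.eval hK hq (fun i ↦ (x i).2) (fun i ↦ (x i).1)
  simp only [invPoch, durfeeSum, Finset.prod_inv_distrib, Finset.prod_univ_sum]
  rw [h]
  refine Finset.sum_congr rfl fun k _ ↦ Finset.sum_congr rfl fun m _ ↦ ?_
  simp only [hdiag, ← Finset.prod_inv_distrib, ← Finset.prod_pow_eq_pow_sum,
    ← Finset.prod_mul_distrib]
  refine Finset.prod_congr rfl fun i _ ↦ ?_
  rw [← qBinom_sub_eq_gaussSub]
  congr 2
  push_cast
  ring

theorem IsDurfeeSystem.add_lt (hDur : IsDurfeeSystem K Q a b) (hK : ∀ i, 0 < K i i)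
    (k : Fin L) (i : Fin n) : Q k i + b k i < K i i := by
  by_contra! hle
  obtain ⟨q, h₀, h₁⟩ : ∃ q : ℚ, 0 < q ∧ q < 1 := exists_between one_pos
  have hq := pow_ne_one_of_lt_one h₀ h₁
  obtain ⟨T, hT⟩ : ∃ T, Q k i + b k i = T + 1 := ⟨Q k i + b k i - 1, by have := hK i; omega⟩
  obtain ⟨M, hM⟩ := Nat.exists_eq_add_of_le' hle
  let w (l : Fin n) : ℕ × ℕ →₀ ℚ :=
    if l = i then Finsupp.single (T + 1, 0) 1 - Finsupp.single (T, 0) 1 -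
      Finsupp.single (M, K i i) (q ^ (T + 1) * invPoch q (K i i, 0))
    else Finsupp.single (Q k l + b k l, 0) 1
  have hφ : linearCombination ℚ (invPoch q) (w i) = 0 := by
    simp only [w, if_true, map_sub, linearCombination_single, smul_eq_mul, one_mul]
    exact invPoch_sub hq (hM.symm.trans hT)
  have hγ (k' : Fin L) : linearCombination ℚ
      (durfeeSum q (K i i) (Q k' i) (a k' i) (b k' i)) (w i) =
      if Q k' i + b k' i = T + 1 then q ^ (a k' i * (Q k' i + b k' i)) *
        invPoch q (Q k' i, 0) else 0 := by
    simp only [w, if_true, map_sub, linearCombination_single, smul_eq_mul, one_mul]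
    exact durfeeSum_sub hq (hK i) (hM.symm.trans hT) _ _ _
  have hw {l : Fin n} (hl : l ≠ i) : w l = Finsupp.single (Q k l + b k l, 0) 1 := if_neg hl
  have h := prod_linearCombination (hDur.prod_invPoch hK hq) w
  rw [Finset.prod_eq_zero (Finset.mem_univ i) hφ] at h
  refine h.not_lt (Finset.sum_pos' (fun k' _ ↦ Finset.prod_nonneg fun l _ ↦ ?_)
    ⟨k, Finset.mem_univ k, Finset.prod_pos fun l _ ↦ ?_⟩)
  · by_cases hl : l = i
    · subst hl
      rw [hγ]
      split_ifs
      · exact (mul_pos (by positivity) (invPoch_pos h₀ h₁ _)).le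
      · rfl
    · rw [hw hl, linearCombination_single, one_smul]
      exact durfeeSum_nonneg h₀ h₁ _ _ _ _ _
  · by_cases hl : l = i
    · subst hl
      rw [hγ, if_pos hT]
      exact mul_pos (by positivity) (invPoch_pos h₀ h₁ _)
    · rw [hw hl, linearCombination_single, one_smul]
      exact durfeeSum_pos h₀ h₁ _ _ _ _

end Diagonal

section Factorization

theorem finsum_prod_eq_prod_sum {ι X F : Type*} [Fintype ι] [DecidableEq ι] [Field F]
    (f : ι → X → F) (S : ι → Finset X) (h : ∀ i, ∀ x ∉ S i, f i x = 0) :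
    ∑ᶠ m : ι → X, ∏ i, f i (m i) = ∏ i, ∑ x ∈ S i, f i x := by
  rw [Finset.prod_univ_sum]
  refine finsum_eq_sum_of_support_subset _ fun m hm ↦ ?_
  rw [Function.mem_support, Finset.prod_ne_zero_iff] at hm
  simp only [Fintype.coe_piFinset, Set.mem_pi, Set.mem_univ, true_imp_iff]
  exact fun i ↦ by_contra fun hi ↦ hm i (Finset.mem_univ i) (h i _ hi)

variable {n D : ℕ}

theorem qv_ne_zero (n : ℕ) : qv n ≠ 0 := by
  simp [qv]

theorem zv_ne_zero (i : Fin n) : zv n i ≠ 0 := by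
  simp [zv]

theorem qv_pow_ne_one (k : ℕ) (hk : 0 < k) : qv n ^ k ≠ 1 := by
  intro h
  rw [qv, ← map_pow, ← map_one (algebraMap (MvPolynomial (Option (Fin n)) ℚ) (FF n))] at h
  have h' := congrArg (MvPolynomial.eval fun _ ↦ (2 : ℚ)) (IsFractionRing.injective _ (FF n) h)
  simp only [map_pow, MvPolynomial.eval_X, map_one] at h'
  exact (one_lt_pow₀ one_lt_two hk.ne').ne' h'

theorem qpow_eq_zpow {r : ℚ} {e : ℤ} (h : 2 * (D : ℚ) * r = e) : qpow n D r = qv n ^ e := by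
  rw [qpow, h, Rat.num_intCast]

theorem qpow_sum {ι : Type*} (s : Finset ι) {r : ι → ℚ}
    (h : ∀ i ∈ s, ∃ e : ℤ, 2 * (D : ℚ) * r i = e) :
    qpow n D (∑ i ∈ s, r i) = ∏ i ∈ s, qpow n D (r i) := by
  choose! e he using h
  rw [qpow_eq_zpow (e := ∑ i ∈ s, e i) (by
      rw [Int.cast_sum, Finset.mul_sum]; exact Finset.sum_congr rfl he),
    Finset.prod_congr rfl fun i hi ↦ qpow_eq_zpow (he i hi)]
  classical
  induction s using Finset.induction_on with
  | empty => simp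
  | insert i s hi ih =>
    rw [Finset.sum_insert hi, Finset.prod_insert hi, zpow_add₀ (qv_ne_zero n),
      ih fun j hj ↦ he j (Finset.mem_insert_of_mem hj)]

theorem qBinomQ_intCast {F : Type*} [Field F] (q : F) (x y : ℤ) :
    qBinomQ q x y = qBinom q x y := by
  simp [qBinomQ]

theorem exists_intCast_of_qBinomQ_ne_zero {F : Type*} [Field F] {q : F} {x y : ℚ}
    (h : qBinomQ q x y ≠ 0) : ∃ t : ℤ, x = t := by
  rw [qBinomQ] at h
  exact ⟨x.num, ((Rat.den_eq_one_iff x).mp (ite_ne_right_iff.mp h).1.1).symm⟩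

theorem le_of_qBinom_ne_zero {F : Type*} [Field F] {q : F} {x y : ℤ} (h : qBinom q x y ≠ 0) :
    0 ≤ y ∧ y ≤ x := by
  rw [qBinom] at h
  exact (ite_ne_right_iff.mp h).1

theorem Zucpf_diagonal (α Qt u : Fin n → ℚ) (z : Fin n → FF n) (S : Fin n → Finset ℕ)
    (hint : ∀ i (m : ℕ), ∃ e : ℤ, 2 * (D : ℚ) * (1 / 2 * (m * (α i * m)) + Qt i * m) = e)
    (hS : ∀ i, ∀ m ∉ S i, qBinomQ (qv n ^ (2 * D)) ((1 - α i) * m + u i) m = 0) :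
    Zucpf n D (diagonal α) Qt u z = ∏ i, ∑ m ∈ S i, z i ^ m *
      qpow n D (1 / 2 * (m * (α i * m)) + Qt i * m) *
      qBinomQ (qv n ^ (2 * D)) ((1 - α i) * m + u i) m := by
  rw [← finsum_prod_eq_prod_sum _ S fun i m hm ↦ by rw [hS i m hm, mul_zero], Zucpf]
  refine finsum_congr fun m ↦ ?_
  have h : (1 : Matrix (Fin n) (Fin n) ℚ) - diagonal α = diagonal fun i ↦ 1 - α i := by
    rw [← diagonal_one, diagonal_sub]
  simp only [h, Pi.add_apply, mulVec_diagonal, dotProduct, Finset.mul_sum,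
    ← Finset.sum_add_distrib, Finset.prod_mul_distrib, qpow_sum _ fun i _ ↦ hint i (m i)]

end Factorization

section Coordinates

variable {n D D' κ : ℕ}

theorem qBinomQ_left_eq_gaussSub {F : Type*} [Field F] (q : F) (κ Q b M m : ℕ) :
    qBinomQ q ((1 - κ) * m + (M - (Q + b))) m = gaussSub q M (κ * m + Q + b) m := by
  rw [← qBinom_sub_eq_gaussSub, ← qBinomQ_intCast]
  congr 1
  push_cast
  ring

theorem qBinomQ_right_eq_gaussSub {F : Type*} [Field F] (q : F) (hκ : 0 < κ) (Q a N r : ℕ) :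
    qBinomQ q ((1 - (κ : ℚ)⁻¹) * (κ * r + Q : ℕ) + (N - (-((κ : ℚ)⁻¹ * Q) + a))) (κ * r + Q : ℕ) =
      gaussSub q N (r + a) (κ * r + Q) := by
  rw [← qBinom_sub_eq_gaussSub, ← qBinomQ_intCast]
  congr 1
  have : (κ : ℚ) ≠ 0 := by positivity
  push_cast
  field_simp
  ring

theorem qBinomQ_right_eq_zero {F : Type*} [Field F] (q : F) {Q : ℕ} (hQ : Q < κ) (a N x : ℕ)
    (hx : x ∉ (Finset.range (N + 1)).image fun r ↦ κ * r + Q) :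
    qBinomQ q ((1 - (κ : ℚ)⁻¹) * x + (N - (-((κ : ℚ)⁻¹ * Q) + a))) x = 0 := by
  by_contra h
  obtain ⟨t, ht⟩ := exists_intCast_of_qBinomQ_ne_zero h
  rw [ht, ← Int.cast_natCast x, qBinomQ_intCast] at h
  have hκ : (κ : ℚ) ≠ 0 := by
    have : κ ≠ 0 := by omega
    exact_mod_cast this
  have hxt : (x : ℤ) = κ * (x + N - a - t) + Q := by
    have : (x : ℚ) = κ * (x + N - a - t) + Q := by
      rw [← ht]; field_simp; ring
    exact_mod_cast this
  have hle := le_of_qBinom_ne_zero h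
  have h₀ : 0 ≤ (x : ℤ) + N - a - t := by
    by_contra! hneg
    nlinarith
  obtain ⟨r, hr⟩ := Int.eq_ofNat_of_zero_le h₀
  refine hx (Finset.mem_image.mpr ⟨r, Finset.mem_range.mpr (by omega), ?_⟩)
  rw [hr] at hxt
  exact_mod_cast hxt.symm

theorem qBinomQ_bilateral_eq {F : Type*} [Field F] (q : F) (hκ : 0 < κ) (M N : ℕ) (s : ℤ) :
    qBinomQ q (M + N + (1 - (κ : ℚ)⁻¹) * (κ * s : ℤ)) (M + (κ * s : ℤ)) =
      qBinom q (M + N + κ * s - s) (M + κ * s) := by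
  rw [← qBinomQ_intCast]
  have : (κ : ℚ) ≠ 0 := by positivity
  congr 1
  · push_cast
    field_simp
    ring
  · push_cast
    ring

theorem qBinomQ_bilateral_eq_zero {F : Type*} [Field F] (q : F) (hκ : 0 < κ) (M N : ℕ) (p : ℤ)
    (hp : p ∉ (Finset.Icc (-M : ℤ) N).image fun s : ℤ ↦ κ * s) :
    qBinomQ q (M + N + (1 - (κ : ℚ)⁻¹) * p) (M + p) = 0 := by
  by_contra h
  obtain ⟨t, ht⟩ := exists_intCast_of_qBinomQ_ne_zero h
  rw [ht, show (M : ℚ) + p = ((M + p : ℤ) : ℚ) by push_cast; rfl, qBinomQ_intCast] at h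
  have hκ' : (κ : ℚ) ≠ 0 := by positivity
  have hpt : p = κ * (M + N + p - t) := by
    have : (p : ℚ) = κ * (M + N + p - t) := by
      rw [← ht]; field_simp; ring
    exact_mod_cast this
  have hle := le_of_qBinom_ne_zero h
  refine hp (Finset.mem_image.mpr ⟨M + N + p - t, Finset.mem_Icc.mpr ⟨?_, by omega⟩, hpt.symm⟩)
  by_contra! hneg
  have : (1 : ℤ) ≤ κ := by omega
  nlinarith

theorem two_mul_exponent_left (κ Q b m : ℕ) :
    2 * (D : ℚ) * (1 / 2 * (m * ((κ : ℚ) * m)) + ((Q : ℚ) + b) * m) =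
      ((D * (κ * m ^ 2 + 2 * (Q + b) * m) : ℤ) : ℚ) := by
  push_cast
  ring

theorem two_mul_exponent_right (hD : D = κ * D') (hκ : 0 < κ) (Q a x : ℕ) :
    2 * (D : ℚ) * (1 / 2 * (x * ((κ : ℚ)⁻¹ * x)) + (-((κ : ℚ)⁻¹ * Q) + a) * x) =
      ((D' * x ^ 2 - 2 * D' * Q * x + 2 * D * a * x : ℤ) : ℚ) := by
  have : (κ : ℚ) ≠ 0 := by positivity
  rw [hD]
  push_cast
  field_simp
  ring

theorem two_mul_exponent_prefactor (hD : D = κ * D') (hκ : 0 < κ) (Q a b : ℕ) :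
    2 * (D : ℚ) * (1 / 2 * (Q * ((κ : ℚ)⁻¹ * Q)) + a * b) =
      ((D' * Q ^ 2 + 2 * D * a * b : ℤ) : ℚ) := by
  have : (κ : ℚ) ≠ 0 := by positivity
  rw [hD]
  push_cast
  field_simp

theorem two_mul_exponent_bilateral (hD : D = κ * D') (hκ : 0 < κ) (p : ℤ) :
    2 * (D : ℚ) * (1 / 2 * (p * ((κ : ℚ)⁻¹ * p))) = ((D' * p ^ 2 : ℤ) : ℚ) := by
  have : (κ : ℚ) ≠ 0 := by positivity
  rw [hD]
  push_cast
  field_simp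

/-- The common monomial factor of all terms with given `r - m = s`. -/
def ucpfWeight (n D κ : ℕ) (z : FF n) (s : ℤ) : FF n := z ^ (κ * s) * qv n ^ (D * κ * s ^ 2)

theorem ucpf_term_eq (hD : D = κ * D') (hκ : 0 < κ) {z : FF n} (hz : z ≠ 0) (Q a b M N m r : ℕ) :
    z ^ (-(Q : ℤ)) * qpow n D (1 / 2 * (Q * ((κ : ℚ)⁻¹ * Q)) + a * b) *
      ((z ^ (-(κ : ℤ))) ^ m * qpow n D (1 / 2 * (m * ((κ : ℚ) * m)) + ((Q : ℚ) + b) * m) *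
        qBinomQ (qv n ^ (2 * D)) ((1 - κ) * m + (M - (Q + b))) m) *
      (z ^ (κ * r + Q) * qpow n D (1 / 2 * ((κ * r + Q : ℕ) * ((κ : ℚ)⁻¹ * (κ * r + Q : ℕ))) +
        (-((κ : ℚ)⁻¹ * Q) + a) * (κ * r + Q : ℕ)) *
        qBinomQ (qv n ^ (2 * D)) ((1 - (κ : ℚ)⁻¹) * (κ * r + Q : ℕ) +
          (N - (-((κ : ℚ)⁻¹ * Q) + a))) (κ * r + Q : ℕ)) =
      ucpfWeight n D κ z (r - m) * ucpfTerm (qv n ^ (2 * D)) κ Q a b M N m r := by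
  rw [qBinomQ_left_eq_gaussSub, qBinomQ_right_eq_gaussSub _ hκ,
    qpow_eq_zpow (two_mul_exponent_left κ Q b m), qpow_eq_zpow (two_mul_exponent_right hD hκ _ _ _),
    qpow_eq_zpow (two_mul_exponent_prefactor hD hκ Q a b), ucpfTerm, ucpfWeight]
  have hv := qv_ne_zero n
  have h₁ : z ^ (-(Q : ℤ)) * (z ^ (-(κ : ℤ))) ^ m * z ^ (κ * r + Q) = z ^ ((κ : ℤ) * (r - m)) := by
    rw [← zpow_natCast, ← zpow_natCast, ← _root_.zpow_mul, ← zpow_add₀ hz, ← zpow_add₀ hz]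
    congr 1
    push_cast
    ring
  have h₂ : qv n ^ (D' * Q ^ 2 + 2 * D * a * b : ℤ) *
      qv n ^ (D * (κ * m ^ 2 + 2 * (Q + b) * m) : ℤ) *
      qv n ^ (D' * ((κ * r + Q : ℕ) : ℤ) ^ 2 - 2 * D' * Q * (κ * r + Q : ℕ) +
        2 * D * a * (κ * r + Q : ℕ) : ℤ) =
      qv n ^ ((D : ℤ) * κ * (r - m) ^ 2) *
        (qv n ^ (2 * D)) ^ ((m + a) * (κ * r + Q + b)) := by
    rw [← pow_mul, ← zpow_natCast, ← zpow_add₀ hv, ← zpow_add₀ hv, ← zpow_add₀ hv]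
    congr 1
    rw [hD]
    push_cast
    ring
  linear_combination (gaussSub (qv n ^ (2 * D)) M (κ * m + Q + b) m *
    gaussSub (qv n ^ (2 * D)) N (r + a) (κ * r + Q)) *
    (qv n ^ (D' * Q ^ 2 + 2 * D * a * b : ℤ) *
      qv n ^ (D * (κ * m ^ 2 + 2 * (Q + b) * m) : ℤ) *
      qv n ^ (D' * ((κ * r + Q : ℕ) : ℤ) ^ 2 - 2 * D' * Q * (κ * r + Q : ℕ) +
        2 * D * a * (κ * r + Q : ℕ) : ℤ) * h₁ + z ^ ((κ : ℤ) * (r - m)) * h₂)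

theorem sum_ucpf_term_eq (hD : D = κ * D') (hκ : 0 < κ) {z : FF n} (hz : z ≠ 0)
    (Q a b M N : ℕ) :
    z ^ (-(Q : ℤ)) * qpow n D (1 / 2 * (Q * ((κ : ℚ)⁻¹ * Q)) + a * b) *
      (∑ m ∈ Finset.range (M + 1), (z ^ (-(κ : ℤ))) ^ m *
        qpow n D (1 / 2 * (m * ((κ : ℚ) * m)) + ((Q : ℚ) + b) * m) *
        qBinomQ (qv n ^ (2 * D)) ((1 - κ) * m + (M - (Q + b))) m) *
      (∑ x ∈ (Finset.range (N + 1)).image fun r ↦ κ * r + Q, z ^ x *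
        qpow n D (1 / 2 * (x * ((κ : ℚ)⁻¹ * x)) + (-((κ : ℚ)⁻¹ * Q) + a) * x) *
        qBinomQ (qv n ^ (2 * D)) ((1 - (κ : ℚ)⁻¹) * x + (N - (-((κ : ℚ)⁻¹ * Q) + a))) x) =
      ∑ m ∈ Finset.range (M + 1), ∑ r ∈ Finset.range (N + 1),
        ucpfWeight n D κ z (r - m) * ucpfTerm (qv n ^ (2 * D)) κ Q a b M N m r := by
  have hinj : Function.Injective fun r ↦ κ * r + Q := fun r s h ↦
    Nat.eq_of_mul_eq_mul_left hκ (Nat.add_right_cancel h)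
  rw [Finset.sum_image hinj.injOn, Finset.mul_sum (Finset.range (M + 1)), Finset.sum_mul_sum]
  exact Finset.sum_congr rfl fun m _ ↦ Finset.sum_congr rfl fun r _ ↦ ucpf_term_eq hD hκ hz Q a b M N m r

theorem sum_bilateral_term_eq (hD : D = κ * D') (hκ : 0 < κ) (z : FF n) (M N : ℕ) :
    ∑ p ∈ (Finset.Icc (-M : ℤ) N).image fun s : ℤ ↦ κ * s,
      z ^ p * qpow n D (1 / 2 * (p * ((κ : ℚ)⁻¹ * p))) *
        qBinomQ (qv n ^ (2 * D)) (M + N + (1 - (κ : ℚ)⁻¹) * p) (M + p) =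
      ∑ s ∈ Finset.Icc (-M : ℤ) N, ucpfWeight n D κ z s *
        qBinom (qv n ^ (2 * D)) (M + N + κ * s - s) (M + κ * s) := by
  have hinj : Function.Injective fun s : ℤ ↦ κ * s := fun r s h ↦
    mul_left_cancel₀ (by exact_mod_cast hκ.ne') h
  rw [Finset.sum_image hinj.injOn]
  refine Finset.sum_congr rfl fun s _ ↦ ?_
  rw [qBinomQ_bilateral_eq _ hκ, qpow_eq_zpow (two_mul_exponent_bilateral hD hκ _), ucpfWeight, hD]
  congr 3
  push_cast
  ring

end Coordinates

/-- Let `K ∈ GL(n, ℤ≥0)` be symmetric and positive definite with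
`det K = D`, and let `(Q k, a k, b k)` be a Durfee system for `K`.  With `q := v^(2D)`,
`Q'⁽ᵏ⁾ := -K⁻¹·Q⁽ᵏ⁾` and `z'_i := ∏_j z_j^(-K_{ij})`, for all `M, N ∈ (ℤ≥0)^n`:
`Σ_k (∏_i z_i^(-Q_i)) q^{½ Q·K⁻¹·Q + a·b}
    ⬝ Z(K; Q+b, M-(Q+b) | z'; q) ⬝ Z(K⁻¹; Q'+a, N-(Q'+a) | z; q)
 = Σ_{p ∈ ℤ^n} (∏_i z_i^{p_i}) q^{½ p·K⁻¹·p}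
    ∏_i [M_i + N_i + ((I-K⁻¹)·p)_i choose M_i + p_i]_q`
in `ℚ(v, z₁, …, z_n)`; all sums have finite support by the vanishing conventions. -/
theorem durfee_ucpf_identity {n L : ℕ} (K : Matrix (Fin n) (Fin n) ℕ)
    (hsym : K.IsSymm) (hpd : (K.map (Nat.cast : ℕ → ℚ)).PosDef)
    (D : ℕ) (hD : (K.map (Nat.cast : ℕ → ℚ)).det = D)
    (Q a b : Fin L → Fin n → ℕ) (hDur : IsDurfeeSystem K Q a b)
    (M N : Fin n → ℕ) :
    ∑ k : Fin L,
      (∏ i, zv n i ^ (-(Q k i : ℤ))) *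
      qpow n D ((1 / 2) * ((fun i => (Q k i : ℚ)) ⬝ᵥ
          (K.map (Nat.cast : ℕ → ℚ))⁻¹.mulVec (fun i => (Q k i : ℚ))) +
        ∑ i, (a k i : ℚ) * (b k i : ℚ)) *
      Zucpf n D (K.map (Nat.cast : ℕ → ℚ))
        (fun i => (Q k i : ℚ) + (b k i : ℚ))
        (fun i => (M i : ℚ) - ((Q k i : ℚ) + (b k i : ℚ)))
        (fun i => ∏ j, zv n j ^ (-(K i j : ℤ))) *
      Zucpf n D (K.map (Nat.cast : ℕ → ℚ))⁻¹
        (fun i => -(K.map (Nat.cast : ℕ → ℚ))⁻¹.mulVec (fun j => (Q k j : ℚ)) i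
          + (a k i : ℚ))
        (fun i => (N i : ℚ) -
          (-(K.map (Nat.cast : ℕ → ℚ))⁻¹.mulVec (fun j => (Q k j : ℚ)) i + (a k i : ℚ)))
        (zv n) =
      ∑ᶠ p : Fin n → ℤ,
        (∏ i, zv n i ^ p i) *
        qpow n D ((1 / 2) * ((fun i => (p i : ℚ)) ⬝ᵥ
          (K.map (Nat.cast : ℕ → ℚ))⁻¹.mulVec (fun i => (p i : ℚ)))) *
        ∏ i, qBinomQ (qv n ^ (2 * D))
          ((M i : ℚ) + (N i : ℚ) +
            (1 - (K.map (Nat.cast : ℕ → ℚ))⁻¹).mulVec (fun j => (p j : ℚ)) i)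
          ((M i : ℚ) + (p i : ℚ)) := by

  have hK (i : Fin n) : 0 < K i i := by
    have := hpd.diag_pos (i := i)
    rw [map_apply] at this
    exact_mod_cast this
  have hdiag {i j : Fin n} (hij : i ≠ j) : K i j = 0 := hDur.eq_zero_of_ne hK hij
  have hKmap : K.map (Nat.cast : ℕ → ℚ) = diagonal fun i ↦ (K i i : ℚ) := by
    ext i j
    by_cases hij : i = j
    · subst hij; simp
    · simp [hij, hdiag hij]
  have hKinv : (K.map (Nat.cast : ℕ → ℚ))⁻¹ = diagonal fun i ↦ (K i i : ℚ)⁻¹ := by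
    rw [hKmap]
    refine inv_eq_right_inv ?_
    rw [diagonal_mul_diagonal, ← diagonal_one]
    congr 1
    funext i
    exact mul_inv_cancel₀ (by exact_mod_cast (hK i).ne')
  have hDprod : D = ∏ i, K i i := by
    rw [hKmap, det_diagonal] at hD
    exact_mod_cast hD.symm
  have hDdvd (i : Fin n) : ∃ D' : ℕ, D = K i i * D' :=
    hDprod ▸ Finset.dvd_prod_of_mem (fun i ↦ K i i) (Finset.mem_univ i)
  choose D' hD' using hDdvd
  have hDpos : 0 < D := hDprod ▸ Finset.prod_pos fun i _ ↦ hK i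
  have hq (k : ℕ) (hk : 0 < k) : (qv n ^ (2 * D)) ^ k ≠ 1 := by
    rw [← pow_mul]
    exact qv_pow_ne_one _ (by positivity)
  have hz (i : Fin n) : ∏ j, zv n j ^ (-(K i j : ℤ)) = zv n i ^ (-(K i i : ℤ)) :=
    Finset.prod_eq_single i (fun j _ hj ↦ by simp [hdiag hj.symm]) (by simp)
  have hsub : (1 : Matrix (Fin n) (Fin n) ℚ) - diagonal (fun i ↦ (K i i : ℚ)⁻¹) =
      diagonal fun i ↦ 1 - (K i i : ℚ)⁻¹ := by
    rw [← diagonal_one, diagonal_sub]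
  choose w hw₁ hw₂ using fun i ↦ exists_weights (pow_ne_zero (2 * D) (qv_ne_zero n)) hq (hK i)
    (∑ k, a k i) (M i) (N i) (ucpfWeight n D (K i i) (zv n i))
  have hRHS : (∑ᶠ p : Fin n → ℤ,
        (∏ i, zv n i ^ p i) *
        qpow n D ((1 / 2) * ((fun i => (p i : ℚ)) ⬝ᵥ
          (K.map (Nat.cast : ℕ → ℚ))⁻¹.mulVec (fun i => (p i : ℚ)))) *
        ∏ i, qBinomQ (qv n ^ (2 * D))
          ((M i : ℚ) + (N i : ℚ) +
            (1 - (K.map (Nat.cast : ℕ → ℚ))⁻¹).mulVec (fun j => (p j : ℚ)) i)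
          ((M i : ℚ) + (p i : ℚ))) =
      ∏ i, Finsupp.linearCombination (FF n) (invPoch (qv n ^ (2 * D))) (w i) := by
    simp only [hw₁, ← sum_bilateral_term_eq (hD' _) (hK _)]
    rw [← finsum_prod_eq_prod_sum _ _ fun i p hp ↦ by
      rw [qBinomQ_bilateral_eq_zero _ (hK i) _ _ p hp, mul_zero]]
    refine finsum_congr fun p ↦ ?_
    simp only [hKinv, hsub, mulVec_diagonal, dotProduct, Finset.mul_sum, Finset.prod_mul_distrib]
    rw [qpow_sum _ fun i _ ↦ ⟨_, two_mul_exponent_bilateral (hD' i) (hK i) (p i)⟩]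
  rw [hRHS, prod_linearCombination (hDur.prod_invPoch hK hq) w]
  refine Finset.sum_congr rfl fun k _ ↦ ?_
  have ha (i : Fin n) : a k i ≤ ∑ k, a k i :=
    Finset.single_le_sum (f := fun k ↦ a k i) (fun _ _ ↦ Nat.zero_le _) (Finset.mem_univ k)
  have hQ (i : Fin n) : Q k i < K i i :=
    (Nat.le_add_right _ _).trans_lt (hDur.add_lt hK k i)
  rw [hKinv, hKmap]
  simp only [hz, mulVec_diagonal]
  rw [Zucpf_diagonal _ _ _ _ (fun i ↦ Finset.range (M i + 1))
      (fun i m ↦ ⟨_, two_mul_exponent_left _ _ _ _⟩) (fun i m hm ↦ ?_),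
    Zucpf_diagonal _ _ _ _ (fun i ↦ (Finset.range (N i + 1)).image fun r ↦ K i i * r + Q k i)
      (fun i m ↦ ⟨_, two_mul_exponent_right (hD' i) (hK i) _ _ _⟩)
      (fun i x hx ↦ qBinomQ_right_eq_zero _ (hQ i) _ _ x hx)]
  · simp only [mulVec_diagonal, dotProduct, Finset.mul_sum (Finset.univ : Finset (Fin n)),
      ← Finset.sum_add_distrib]
    rw [qpow_sum _ fun i _ ↦ ⟨_, two_mul_exponent_prefactor (hD' i) (hK i) _ _ _⟩]
    simp only [← Finset.prod_mul_distrib]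
    refine Finset.prod_congr rfl fun i _ ↦ ?_
    rw [hw₂ i _ _ _ (ha i)]
    exact sum_ucpf_term_eq (hD' i) (hK i) (zv_ne_zero i) _ _ _ _ _
  · rw [qBinomQ_left_eq_gaussSub, add_assoc, gaussSub_of_lt]
    exact lt_mul_add_of_lt (hK i) (by simpa using hm) _
end
end

section
/- Let K be an invertible symmetric n×n matrix with nonnegative integer entries and let (Q^(k), a^(k), b^(k)), k = 0, …, L−1, be a Durfee system for K. Then the following identity holds in the ring of formal power series ℤ[[z₁, …, z_n, q]]: 1/∏_i (z_i q; q)_∞ = Σ_{k=0}^{L−1} Σ_{m ∈ (ℤ≥0)^n} (∏_i z_i^{m_i + a^(k)_i}) · q^{(m + a^(k))·(N + b^(k))} / (∏_i (q;q)_{m_i} (z_i q; q)_{N_i}), where N := K·m + Q^(k), and the factors (q;q)_{m_i} and (z_i q; q)_{N_i} are inverted as units of the power series ring; each monomial in z₁,…,z_n receives contributions from only finitely many terms, so the right-hand side is a well-defined formal power series. -/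
open Matrix

noncomputable section

/-- The product (coefficient-wise) topology on multivariate formal power series over `ℤ`. -/
instance (σ : Type*) : TopologicalSpace (MvPowerSeries σ ℤ) :=
  inferInstanceAs (TopologicalSpace ((σ →₀ ℕ) → ℤ))

/-- The ring `ℤ[[z₁, …, z_n, q]]`: `q` is the variable indexed by `none`, and
`z₁, …, z_n` are the variables indexed by `some i`. -/
abbrev PS (n : ℕ) := MvPowerSeries (Option (Fin n)) ℤ

/-- The variable `q` of `ℤ[[z₁, …, z_n, q]]`. -/
def qq (n : ℕ) : PS n := MvPowerSeries.X (none : Option (Fin n))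

/-- The variables `z i` of `ℤ[[z₁, …, z_n, q]]`. -/
def zz (n : ℕ) (i : Fin n) : PS n := MvPowerSeries.X (some i)

open Filter Topology MvPowerSeries

open scoped MvPowerSeries.WithPiTopology in
instance (σ : Type*) : IsTopologicalRing (MvPowerSeries σ ℤ) :=
  WithPiTopology.instIsTopologicalRing σ ℤ

open scoped MvPowerSeries.WithPiTopology in
instance (σ : Type*) : T2Space (MvPowerSeries σ ℤ) :=
  WithPiTopology.instT2Space

theorem tendsto_iff_eventually_coeff_eq {σ ι : Type*} {f : ι → MvPowerSeries σ ℤ} {u : Filter ι}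
    {g : MvPowerSeries σ ℤ} :
    Tendsto f u (𝓝 g) ↔ ∀ d, ∀ᶠ t in u, coeff d (f t) = coeff d g := by
  refine (WithPiTopology.tendsto_iff_coeff_tendsto f u g).trans ?_
  simp [nhds_discrete]

theorem summable_of_finite_coeff_support {σ ι : Type*} {g : ι → MvPowerSeries σ ℤ}
    (h : ∀ d, {m | coeff d (g m) ≠ 0}.Finite) : Summable g := by
  refine (WithPiTopology.summable_iff_summable_coeff).mpr fun d => ?_
  exact summable_of_hasFiniteSupport (h d)

theorem coeff_tsum_of_finite_coeff_support {σ ι : Type*} {g : ι → MvPowerSeries σ ℤ}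
    (h : ∀ d, {m | coeff d (g m) ≠ 0}.Finite) (d : σ →₀ ℕ) (s : Finset ι)
    (hs : ∀ m ∉ s, coeff d (g m) = 0) :
    coeff d (∑' m, g m) = ∑ m ∈ s, coeff d (g m) := by
  have h1 := (WithPiTopology.hasSum_iff_hasSum_coeff).mp
    (summable_of_finite_coeff_support h).hasSum d
  exact h1.unique (hasSum_sum_of_ne_finset_zero hs)

section Monomials

variable {n : ℕ}

theorem coeff_eq_zero_of_prod_zz_pow_dvd {m : Fin n → ℕ} {F : PS n}
    (h : (∏ i, zz n i ^ m i) ∣ F) {d : Option (Fin n) →₀ ℕ} (hd : ¬ m ≤ fun i => d (some i)) :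
    coeff d F = 0 := by
  obtain ⟨i, hi⟩ : ∃ i, d (some i) < m i := by simpa [Pi.le_def] using hd
  exact X_pow_dvd_iff.mp
    ((Finset.dvd_prod_of_mem (fun i => zz n i ^ m i) (Finset.mem_univ i)).trans h) d hi

theorem tendsto_sum_Iic_tsum {f : ℕ → (Fin n → ℕ) → PS n} {g : (Fin n → ℕ) → PS n}
    (hf : ∀ t m, (∏ i, zz n i ^ m i) ∣ f t m) (hg : ∀ m, (∏ i, zz n i ^ m i) ∣ g m)
    (hfg : ∀ m, Tendsto (f · m) atTop (𝓝 (g m))) :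
    Tendsto (fun t => ∑ m ∈ Finset.Iic (fun _ => t), f t m) atTop (𝓝 (∑' m, g m)) := by
  rw [tendsto_iff_eventually_coeff_eq]
  intro d
  have hfin : ∀ d, {m | coeff d (g m) ≠ 0}.Finite := fun d =>
    (Set.finite_Iic (fun i => d (some i))).subset fun m hm => by
      by_contra hmd
      exact hm (coeff_eq_zero_of_prod_zz_pow_dvd (hg m) hmd)
  set D : Fin n → ℕ := fun i => d (some i)
  rw [coeff_tsum_of_finite_coeff_support hfin d (Finset.Iic D) fun m hm =>
    coeff_eq_zero_of_prod_zz_pow_dvd (hg m) (by simpa using hm)]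
  have hev : ∀ᶠ t in atTop, ∀ m ∈ Finset.Iic D, coeff d (f t m) = coeff d (g m) := by
    rw [Finset.eventually_all]
    exact fun m _ => tendsto_iff_eventually_coeff_eq.mp (hfg m) d
  filter_upwards [hev, eventually_ge_atTop (∑ i, D i)] with t ht htD
  rw [map_sum, ← Finset.sum_congr rfl ht]
  refine (Finset.sum_subset ?_ fun m _ hm =>
    coeff_eq_zero_of_prod_zz_pow_dvd (hf t m) (by simpa using hm)).symm
  refine Finset.Iic_subset_Iic.mpr fun i => ?_
  exact (Finset.single_le_sum (fun _ _ => Nat.zero_le _) (Finset.mem_univ i)).trans htD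

theorem tendsto_qq_pow : Tendsto (fun k : ℕ => qq n ^ k) atTop (𝓝 0) := by
  rw [tendsto_iff_eventually_coeff_eq]
  intro d
  filter_upwards [eventually_gt_atTop (d none)] with k hk
  rw [X_pow_dvd_iff.mp dvd_rfl d hk, map_zero]

theorem tendsto_qPoch_tprod (i : Fin n) :
    Tendsto (fun t => qPoch (qq n) (zz n i * qq n) t) atTop
      (𝓝 (∏' k : ℕ, (1 - zz n i * qq n ^ (k + 1)))) := by
  have hmul : Multipliable fun k : ℕ => 1 + -(zz n i * qq n ^ (k + 1)) := by
    refine WithPiTopology.multipliable_one_add_of_tendsto_order_atTop_nhds_top ?_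
    rw [ENat.tendsto_nhds_top_iff_natCast_lt]
    intro N
    filter_upwards [eventually_ge_atTop N] with k hk
    have h1 : ((k + 1 : ℕ) : ℕ∞) ≤ (-(zz n i * qq n ^ (k + 1))).order := by
      refine nat_le_order fun d hd => ?_
      rw [map_neg, X_pow_dvd_iff.mp (Dvd.intro_left _ rfl) d ((Finsupp.le_degree none d).trans_lt hd),
        neg_zero]
    exact lt_of_lt_of_le (by exact_mod_cast Nat.lt_succ_of_le hk) h1
  have h := hmul.hasProd.tendsto_prod_nat
  simp only [← sub_eq_add_neg] at h
  refine h.congr fun t => Finset.prod_congr rfl fun k _ => ?_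
  rw [pow_succ']
  ring

end Monomials

section Units

variable {n : ℕ}

theorem isUnit_qPoch (w : PS n) (M : ℕ) : IsUnit (qPoch (qq n) (w * qq n) M) := by
  simp [isUnit_iff_constantCoeff, qPoch, qq]

theorem isUnit_qPoch_qq (M : ℕ) : IsUnit (qPoch (qq n) (qq n) M) := by
  simpa using isUnit_qPoch (n := n) 1 M

theorem isUnit_prod_qPoch (M : Fin n → ℕ) :
    IsUnit (∏ i, qPoch (qq n) (zz n i * qq n) (M i)) :=
  IsUnit.prod_univ_iff.mpr fun _ => isUnit_qPoch _ _

end Units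

theorem map_ring_inverse {R F : Type*} [CommRing R] [Field F] (ι : R →+* F) {x : R}
    (hx : IsUnit x) : ι (Ring.inverse x) = (ι x)⁻¹ := by
  refine eq_inv_of_mul_eq_one_left ?_
  rw [← map_mul, Ring.inverse_mul_cancel x hx, map_one]

theorem map_qPoch {R S : Type*} [CommRing R] [CommRing S] (φ : R →+* S) (q z : R) (M : ℕ) :
    φ (qPoch q z M) = qPoch (φ q) (φ z) M := by
  simp [qPoch, map_prod]

theorem qPoch_self_add {R : Type*} [CommRing R] (q : R) (s m : ℕ) :
    qPoch q q (s + m) = qPoch q q s * ∏ j ∈ Finset.range m, (1 - q * q ^ (s + j)) :=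
  Finset.prod_range_add _ _ _

/-- The q-binomial `[s + m choose m]_q` as a power series. -/
def qBinomSeries (n s m : ℕ) : PS n :=
  Ring.inverse (qPoch (qq n) (qq n) m) * ∏ j ∈ Finset.range m, (1 - qq n * qq n ^ (s + j))

theorem map_qBinomSeries {n : ℕ} {F : Type*} [Field F] (φ : FF n →+* F) (ι : PS n →+* F)
    (hq : φ (qv n) = ι (qq n)) (M m c : ℕ) :
    φ (qBinom (qv n) ((M : ℤ) + m - c) m) =
      ι (if c ≤ M then qBinomSeries n (M - c) m else 0) := by
  by_cases h : c ≤ M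
  · obtain ⟨s, rfl⟩ := Nat.exists_eq_add_of_le h
    have h1 : ((c + s : ℕ) : ℤ) + m - c = ((s + m : ℕ) : ℤ) := by push_cast; ring
    have h2 : ((s + m : ℕ) : ℤ) - m = (s : ℤ) := by push_cast; ring
    have hs : ι (qPoch (qq n) (qq n) s) ≠ 0 := ((isUnit_qPoch_qq s).map ι).ne_zero
    rw [h1, qBinom, if_pos (by omega), if_pos h, h2, Int.toNat_natCast, Int.toNat_natCast,
      Int.toNat_natCast, map_div₀, map_mul, map_qPoch, map_qPoch, map_qPoch, hq, qBinomSeries,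
      map_mul, map_ring_inverse ι (isUnit_qPoch_qq m), Nat.add_sub_cancel_left,
      ← map_qPoch, ← map_qPoch, ← map_qPoch, qPoch_self_add, map_mul]
    field_simp
  · rw [qBinom, if_neg (by omega), if_neg h, map_zero, map_zero]

theorem tendsto_qBinomSeries (n c m : ℕ) :
    Tendsto (fun M : ℕ => if c ≤ M then qBinomSeries n (M - c) m else 0) atTop
      (𝓝 (Ring.inverse (qPoch (qq n) (qq n) m))) := by
  have h : Tendsto (fun s => qBinomSeries n s m) atTop
      (𝓝 (Ring.inverse (qPoch (qq n) (qq n) m))) := by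
    have hj : ∀ j ∈ Finset.range m,
        Tendsto (fun s => 1 - qq n * qq n ^ (s + j)) atTop (𝓝 (1 - qq n * 0)) := fun j _ =>
      tendsto_const_nhds.sub (tendsto_const_nhds.mul
        (tendsto_qq_pow.comp (tendsto_add_atTop_nat j)))
    simpa [qBinomSeries] using (tendsto_const_nhds (x := Ring.inverse (qPoch (qq n) (qq n) m))).mul
      (tendsto_finsetProd _ hj)
  refine (h.comp (tendsto_sub_atTop_nat c)).congr' ?_
  filter_upwards [eventually_ge_atTop c] with M hM
  simp [hM]

/-- The fraction field of `ℚ[[z₁, …, z_n, q]]`, which contains both `ℚ(q, z₁, …, z_n)` and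
`ℤ[[z₁, …, z_n, q]]`. -/
abbrev SeriesField (n : ℕ) := FractionRing (MvPowerSeries (Option (Fin n)) ℚ)

theorem exists_common_field_embedding (n : ℕ) :
    ∃ (φ : FF n →+* SeriesField n) (ι : PS n →+* SeriesField n), Function.Injective ι ∧
      φ (qv n) = ι (qq n) ∧ ∀ i, φ (zv n i) = ι (zz n i) := by
  have hinj : Function.Injective ((algebraMap (MvPowerSeries (Option (Fin n)) ℚ)
      (SeriesField n)).comp MvPolynomial.coeToMvPowerSeries.ringHom) :=
    (IsFractionRing.injective (MvPowerSeries (Option (Fin n)) ℚ) (SeriesField n)).comp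
      (MvPolynomial.coe_injective (Option (Fin n)) ℚ)
  refine ⟨IsFractionRing.lift hinj,
    (algebraMap _ (SeriesField n)).comp (MvPowerSeries.map (Int.castRingHom ℚ)), ?_, ?_, ?_⟩
  · refine (IsFractionRing.injective (MvPowerSeries (Option (Fin n)) ℚ) (SeriesField n)).comp ?_
    intro f g hfg
    ext d
    simpa using congrArg (coeff d) hfg
  · simp [qv, qq]
  · simp [zv, zz]

theorem le_mulVec_of_det_ne_zero {n : ℕ} (K : Matrix (Fin n) (Fin n) ℕ)
    (hdet : (K.map (Nat.cast : ℕ → ℚ)).det ≠ 0) (m : Fin n → ℕ) (j : Fin n) :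
    ∃ i, m j ≤ K.mulVec m i := by
  obtain ⟨i, hi⟩ : ∃ i, K i j ≠ 0 := by
    by_contra! h
    exact hdet (Matrix.det_eq_zero_of_column_eq_zero j fun i => by simp [h i])
  refine ⟨i, (Nat.le_mul_of_pos_left (m j) (Nat.pos_of_ne_zero hi)).trans ?_⟩
  exact Finset.single_le_sum (f := fun j => K i j * m j) (fun _ _ => Nat.zero_le _)
    (Finset.mem_univ j)

/-- The summand of a Durfee identity with all `M i` equal to `t`, as a power series. -/
def durfeeTerm {n : ℕ} (N m a b : Fin n → ℕ) (t : ℕ) : PS n :=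
  (∏ i, zz n i ^ (m i + a i)) * qq n ^ (∑ i, (m i + a i) * (N i + b i)) *
    Ring.inverse (∏ i, qPoch (qq n) (zz n i * qq n) (N i)) *
    ∏ i, if N i + b i ≤ t then qBinomSeries n (t - (N i + b i)) (m i) else 0

theorem prod_zz_pow_dvd_prod_zz_pow_add {n : ℕ} (m a : Fin n → ℕ) :
    (∏ i, zz n i ^ m i) ∣ ∏ i, zz n i ^ (m i + a i) :=
  Finset.prod_dvd_prod_of_dvd _ _ fun _ _ => pow_dvd_pow _ (Nat.le_add_right _ _)

theorem tendsto_durfeeTerm {n : ℕ} (N m a b : Fin n → ℕ) :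
    Tendsto (durfeeTerm N m a b) atTop
      (𝓝 ((∏ i, zz n i ^ (m i + a i)) * qq n ^ (∑ i, (m i + a i) * (N i + b i)) *
        Ring.inverse (∏ i, qPoch (qq n) (qq n) (m i) *
          qPoch (qq n) (zz n i * qq n) (N i)))) := by
  have hu : IsUnit (∏ i, qPoch (qq n) (qq n) (m i)) :=
    IsUnit.prod_univ_iff.mpr fun _ => isUnit_qPoch_qq _
  have hinv : Ring.inverse (∏ i, qPoch (qq n) (qq n) (m i)) =
      ∏ i, Ring.inverse (qPoch (qq n) (qq n) (m i)) := by
    rw [← mul_one (Ring.inverse _), Ring.inverse_mul_eq_iff_eq_mul _ _ _ hu,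
      ← Finset.prod_mul_distrib]
    exact (Finset.prod_eq_one fun _ _ => Ring.mul_inverse_cancel _ (isUnit_qPoch_qq _)).symm
  rw [Finset.prod_mul_distrib, Ring.inverse_mul (Or.inl hu), hinv, ← mul_assoc]
  exact tendsto_const_nhds.mul (tendsto_finsetProd _ fun i _ => tendsto_qBinomSeries _ _ _)

theorem IsDurfeeSystem.inverse_prod_qPoch_eq {n L : ℕ} {K : Matrix (Fin n) (Fin n) ℕ}
    (hdet : (K.map (Nat.cast : ℕ → ℚ)).det ≠ 0) {Q a b : Fin L → Fin n → ℕ}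
    (hDur : IsDurfeeSystem K Q a b) (t : ℕ) :
    Ring.inverse (∏ i, qPoch (qq n) (zz n i * qq n) t) =
      ∑ k : Fin L, ∑ m ∈ Finset.Iic (fun _ : Fin n => t),
        durfeeTerm (fun i => K.mulVec m i + Q k i) m (a k) (b k) t := by
  obtain ⟨φ, ι, hι, hq, hz⟩ := exists_common_field_embedding n
  apply hι
  have hN : ∀ N : Fin n → ℕ, φ (∏ i, qPoch (qv n) (zv n i * qv n) (N i))⁻¹ =
      ι (Ring.inverse (∏ i, qPoch (qq n) (zz n i * qq n) (N i))) := fun N => by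
    rw [map_ring_inverse ι (isUnit_prod_qPoch N), map_inv₀]
    simp only [map_prod, map_qPoch, map_mul, hq, hz]
  rw [← hN fun _ => t, hDur fun _ => t, map_sum, map_sum]
  refine Finset.sum_congr rfl fun k _ => ?_
  rw [finsum_eq_finsetSum_of_support_subset (s := Finset.Iic (fun _ : Fin n => t)), map_sum,
    map_sum]
  · refine Finset.sum_congr rfl fun m _ => ?_
    rw [map_mul, map_mul, hN fun i => K.mulVec m i + Q k i]
    simp only [durfeeTerm, map_mul, map_prod, map_pow, hq, hz]
    congr 1
    refine Finset.prod_congr rfl fun i _ => ?_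
    rw [← map_qBinomSeries φ ι hq]
    congr 2
    push_cast
    ring
  · intro m hm
    rw [Finset.coe_Iic, Set.mem_Iic]
    intro j
    obtain ⟨i, hi⟩ := le_mulVec_of_det_ne_zero K hdet m j
    have hne := Finset.prod_ne_zero_iff.mp (right_ne_zero_of_mul hm) i (Finset.mem_univ i)
    have := (ite_ne_right_iff.mp hne).1
    show m j ≤ t
    omega

/-- If `(Q k, a k, b k)` is a Durfee system for an invertible
symmetric `K ∈ GL(n, ℤ≥0)`, then in `ℤ[[z₁, …, z_n, q]]`:
`1/∏_i (z_i q; q)_∞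
  = Σ_k Σ_{m ∈ (ℤ≥0)^n} (∏_i z_i^{m_i + a_i}) q^{(m+a)·(N+b)} / ∏_i (q;q)_{m_i} (z_i q;q)_{N_i}`
with `N := K·m + Q k`.  The infinite product `(z_i q;q)_∞ = ∏_{k≥1}(1 - z_i q^k)` is a
coefficient-wise convergent `tprod`; its finite product over `i` has constant
coefficient `1` and is inverted as a unit via `Ring.inverse`, as are the finite
Pochhammer products on the right.  Each monomial in `z₁, …, z_n` receives contributions
from only finitely many terms, so the inner `tsum` converges coefficient-wise. -/
theorem durfee_infinite_product_identity {n L : ℕ} (K : Matrix (Fin n) (Fin n) ℕ)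
    (hsym : K.IsSymm) (hdet : (K.map (Nat.cast : ℕ → ℚ)).det ≠ 0)
    (Q a b : Fin L → Fin n → ℕ) (hDur : IsDurfeeSystem K Q a b) :
    Ring.inverse (∏ i, ∏' k : ℕ, (1 - zz n i * qq n ^ (k + 1))) =
      ∑ k : Fin L, ∑' m : Fin n → ℕ,
        (∏ i, zz n i ^ (m i + a k i)) *
        qq n ^ (∑ i, (m i + a k i) * (K.mulVec m i + Q k i + b k i)) *
        Ring.inverse (∏ i,
          qPoch (qq n) (qq n) (m i) *
          qPoch (qq n) (zz n i * qq n) (K.mulVec m i + Q k i)) := by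
  let R : PS n := ∑ k : Fin L, ∑' m : Fin n → ℕ,
    (∏ i, zz n i ^ (m i + a k i)) *
    qq n ^ (∑ i, (m i + a k i) * (K.mulVec m i + Q k i + b k i)) *
    Ring.inverse (∏ i,
      qPoch (qq n) (qq n) (m i) *
      qPoch (qq n) (zz n i * qq n) (K.mulVec m i + Q k i))
  have hR : Tendsto (fun t => ∑ k : Fin L, ∑ m ∈ Finset.Iic (fun _ : Fin n => t),
      durfeeTerm (fun i => K.mulVec m i + Q k i) m (a k) (b k) t) atTop (𝓝 R) :=
    tendsto_finsetSum _ fun k _ => tendsto_sum_Iic_tsum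
      (fun t m => by
        simp only [durfeeTerm, mul_assoc]
        exact (prod_zz_pow_dvd_prod_zz_pow_add m (a k)).mul_right _)
      (fun m => by
        simp only [mul_assoc]
        exact (prod_zz_pow_dvd_prod_zz_pow_add m (a k)).mul_right _)
      fun m => tendsto_durfeeTerm _ _ _ _
  have hA : Tendsto (fun t => ∏ i, qPoch (qq n) (zz n i * qq n) t) atTop
      (𝓝 (∏ i, ∏' k : ℕ, (1 - zz n i * qq n ^ (k + 1)))) :=
    tendsto_finsetProd _ fun i _ => tendsto_qPoch_tprod i
  have hAR : (∏ i, ∏' k : ℕ, (1 - zz n i * qq n ^ (k + 1))) * R = 1 := by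
    refine tendsto_nhds_unique (hA.mul hR) (tendsto_const_nhds.congr fun t => ?_)
    rw [← hDur.inverse_prod_qPoch_eq hdet t,
      Ring.mul_inverse_cancel _ (isUnit_prod_qPoch fun _ => t)]
  change _ = R
  rw [← mul_one (Ring.inverse _),
    Ring.inverse_mul_eq_iff_eq_mul _ _ _ (IsUnit.of_mul_eq_one _ hAR), hAR]
end
end
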